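/- arXiv:0908.3411 — 4 statements merged into one kernel-verified Lean document; each statement's English description precedes it below -/
import Mathlib

section
/- Let 0 < β ≤ 1 and 0 < c ≤ 1/1000. Let D be a loopless multidigraph on a vertex set X such that for every pair of distinct vertices the total number of edges of D between them (counting both directions and multiplicities) is at most 1/β, and such that every vertex of D has outdegree and indegree at least (1/2 − c)|X|/β. Then for all (not necessarily disjoint) subsets A, B ⊆ X with |A|, |B| ≥ (1/2 − c)|X|, the number of edges of D directed from A to B (counted with multiplicity) is at least |X|²/(60β). -/
open scoped Classical

/-- Outdegree (with multiplicity) of a vertex in a multidigraph `D : V → V → ℕ`. -/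
def outDegM {V : Type*} [Fintype V] (D : V → V → ℕ) (v : V) : ℕ := ∑ u, D v u

/-- Indegree (with multiplicity) of a vertex in a multidigraph `D : V → V → ℕ`. -/
def inDegM {V : Type*} [Fintype V] (D : V → V → ℕ) (v : V) : ℕ := ∑ u, D u v

/-- Number of edges (with multiplicity) of the multidigraph `D` directed from `A` to `B`. -/
def eM {V : Type*} (D : V → V → ℕ) (A B : Finset V) : ℕ := ∑ a ∈ A, ∑ b ∈ B, D a b

/-- Among pairs `(u, v)` with exactly one of `x u = 1`, `y v = 1`, the total weight is bounded in
terms of the sizes of the supports of `x`, `y` and their intersection, if opposite weights sum to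
at most one. -/
theorem two_mul_sum_weight_xor_le {V : Type*} [Fintype V] (W : V → V → ℝ)
    (hW : ∀ u v, 0 ≤ W u v) (hW1 : ∀ u v, W u v + W v u ≤ 1) (x y : V → ℝ)
    (hx : ∀ v, x v = 0 ∨ x v = 1) (hy : ∀ v, y v = 0 ∨ y v = 1) :
    2 * ∑ u, ∑ v, W u v * (x u + y v - 2 * (x u * y v)) ≤
      2 * (Fintype.card V : ℝ) * (∑ v, x v + ∑ v, y v) - 4 * ((∑ v, x v) * ∑ v, y v)
        - (∑ v, x v) ^ 2 - (∑ v, y v) ^ 2 - 2 * (Fintype.card V : ℝ) * ∑ v, x v * y v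
        + 4 * (∑ v, x v * y v) * (∑ v, x v + ∑ v, y v) - 4 * (∑ v, x v * y v) ^ 2 := by
  have hpt : ∀ u v, W u v * (x u + y v - 2 * (x u * y v)) + W v u * (x v + y u - 2 * (x v * y u))
      ≤ (x u + y v - 2 * (x u * y v)) + (x v + y u - 2 * (x v * y u))
        - (x u + y v - 2 * (x u * y v)) * (x v + y u - 2 * (x v * y u)) := by
    intro u v
    have h1 := hW u v
    have h2 := hW v u
    have h3 := hW1 u v
    rcases hx u with a | a <;> rcases hx v with b | b <;> rcases hy u with c | c <;>
      rcases hy v with d | d <;> rw [a, b, c, d] <;> linarith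
  have hsum := Finset.sum_le_sum fun u (_ : u ∈ Finset.univ) =>
    Finset.sum_le_sum fun v (_ : v ∈ Finset.univ) => hpt u v
  have hleft : ∑ u, ∑ v, (W u v * (x u + y v - 2 * (x u * y v))
      + W v u * (x v + y u - 2 * (x v * y u)))
      = 2 * ∑ u, ∑ v, W u v * (x u + y v - 2 * (x u * y v)) := by
    simp only [Finset.sum_add_distrib]
    rw [Finset.sum_comm (f := fun u v => W v u * (x v + y u - 2 * (x v * y u)))]
    ring
  have hexpand : ∀ u v, (x u + y v - 2 * (x u * y v)) + (x v + y u - 2 * (x v * y u))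
        - (x u + y v - 2 * (x u * y v)) * (x v + y u - 2 * (x v * y u))
      = x u * 1 + 1 * y v + 1 * x v + y u * 1 - 2 * (x u * y v) - 2 * (y u * x v)
        - x u * x v - y u * y v - (x u * y u) * 1 - 1 * (x v * y v)
        + 2 * ((x u * y u) * x v) + 2 * (y u * (x v * y v)) + 2 * (x u * (x v * y v))
        + 2 * ((x u * y u) * y v) - 4 * ((x u * y u) * (x v * y v)) := by
    intro u v
    ring
  rw [hleft] at hsum
  refine hsum.trans (le_of_eq ?_)
  simp only [hexpand, Finset.sum_add_distrib, Finset.sum_sub_distrib, ← Finset.mul_sum,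
    ← Finset.sum_mul, Finset.sum_const, Finset.card_univ, nsmul_eq_mul]
  ring

/-- in a loopless multidigraph with at most `1/β` edges between any pair of
vertices and minimum semidegree at least `(1/2 − c)|X|/β`, any two sets `A`, `B` of size at
least `(1/2 − c)|X|` are joined by at least `|X|²/(60β)` edges from `A` to `B`. -/
theorem multidigraph_many_edges_between_large_sets :
    ∀ β c : ℝ, 0 < β → β ≤ 1 → 0 < c → c ≤ 1/1000 →
    ∀ (V : Type) [Fintype V],
    ∀ D : V → V → ℕ,
      (∀ v, D v v = 0) →
      (∀ u v : V, u ≠ v → ((D u v + D v u : ℕ) : ℝ) ≤ 1/β) →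
      (∀ v, (1/2 - c) * (Fintype.card V : ℝ) / β ≤ (outDegM D v : ℝ) ∧
            (1/2 - c) * (Fintype.card V : ℝ) / β ≤ (inDegM D v : ℝ)) →
    ∀ A B : Finset V,
      (1/2 - c) * (Fintype.card V : ℝ) ≤ (A.card : ℝ) →
      (1/2 - c) * (Fintype.card V : ℝ) ≤ (B.card : ℝ) →
      (Fintype.card V : ℝ)^2 / (60 * β) ≤ (eM D A B : ℝ) := by
  intro β c hβ _ hc hc' V _ D hloop hpair hdeg A B hA hB
  set n : ℝ := (Fintype.card V : ℝ)
  let x : V → ℝ := fun v => if v ∈ A then 1 else 0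
  let y : V → ℝ := fun v => if v ∈ B then 1 else 0
  have hx : ∀ v, x v = 0 ∨ x v = 1 := fun v => by by_cases h : v ∈ A <;> simp [x, h]
  have hy : ∀ v, y v = 0 ∨ y v = 1 := fun v => by by_cases h : v ∈ B <;> simp [y, h]
  have hxsum : ∑ v, x v = A.card := by simp [x]
  have hysum : ∑ v, y v = B.card := by simp [y]
  have hW1 : ∀ u v, β * D u v + β * D v u ≤ 1 := by
    intro u v
    by_cases huv : u = v
    · subst huv
      simp [hloop]
    · have h := hpair u v huv
      rw [le_div_iff₀ hβ] at h
      push_cast at h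
      linarith
  have key := two_mul_sum_weight_xor_le (fun u v => β * (D u v : ℝ))
    (fun u v => by positivity) hW1 x y hx hy
  have hE : ∑ u, ∑ v, β * (D u v : ℝ) * (x u * y v) = β * eM D A B := by
    simp [eM, x, y, Finset.mul_sum, Finset.sum_ite_mem]
  have hout : (1/2 - c) * n * A.card ≤ ∑ u, ∑ v, β * (D u v : ℝ) * x u := by
    rw [← hxsum, Finset.mul_sum]
    refine Finset.sum_le_sum fun u _ => ?_
    rw [← Finset.sum_mul, ← Finset.mul_sum]
    have h := (hdeg u).1
    rw [div_le_iff₀ hβ, outDegM] at h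
    push_cast at h
    refine mul_le_mul_of_nonneg_right (by linarith) ?_
    rcases hx u with h | h <;> simp [h]
  have hin : (1/2 - c) * n * B.card ≤ ∑ u, ∑ v, β * (D u v : ℝ) * y v := by
    rw [← hysum, Finset.mul_sum, Finset.sum_comm]
    refine Finset.sum_le_sum fun v _ => ?_
    rw [← Finset.sum_mul, ← Finset.mul_sum]
    have h := (hdeg v).2
    rw [div_le_iff₀ hβ, inDegM] at h
    push_cast at h
    refine mul_le_mul_of_nonneg_right (by linarith) ?_
    rcases hy v with h | h <;> simp [h]
  have hsplit : ∑ u, ∑ v, β * (D u v : ℝ) * (x u + y v - 2 * (x u * y v))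
      = ∑ u, ∑ v, β * (D u v : ℝ) * x u + ∑ u, ∑ v, β * (D u v : ℝ) * y v
        - 2 * (β * eM D A B) := by
    rw [← hE]
    simp only [Finset.mul_sum, ← Finset.sum_add_distrib, ← Finset.sum_sub_distrib]
    refine Finset.sum_congr rfl fun u _ => Finset.sum_congr rfl fun v _ => ?_
    ring
  rw [hsplit, hxsum, hysum] at key
  have hn : 0 ≤ n := Nat.cast_nonneg _
  have hAn : (A.card : ℝ) ≤ n := Nat.cast_le.mpr (Finset.card_le_univ A)
  have hBn : (B.card : ℝ) ≤ n := Nat.cast_le.mpr (Finset.card_le_univ B)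
  rw [div_le_iff₀ (by positivity)]
  set a : ℝ := (A.card : ℝ)
  set b : ℝ := (B.card : ℝ)
  set i : ℝ := ∑ v, x v * y v
  have hA' : 499 / 1000 * n ≤ a := by nlinarith
  have hB' : 499 / 1000 * n ≤ b := by nlinarith
  have hab : (499 / 1000 * n) * (499 / 1000 * n) ≤ a * b :=
    mul_le_mul hA' hB' (by positivity) (by positivity)
  have hcn : c * (n * (a + b)) ≤ 1 / 1000 * (n * (n + n)) := by gcongr
  have hsq := sq_nonneg (4 * i - (2 * (a + b) - n))
  change 2 * _ ≤ 2 * n * (a + b) - _ - _ - _ - 2 * n * i + _ - _ at key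
  nlinarith [sq_nonneg n]
end

section
/- Suppose 0 < 1/L ≪ β ≪ η ≪ d ≪ c ≪ 1 (each parameter sufficiently small in terms of the ones to its right, and L sufficiently large). Let D be a loopless multidigraph on L vertices such that for every pair of distinct vertices the total number of edges of D between them (counting both directions and multiplicities) is at most 1/β, every vertex has out- and indegree at least (1/2 − 4d)L/β, and every vertex has out- and indegree at most (1/2 + 2η)L/β. Set r := (1/2 − c)L/β. Then there exist pairwise edge-disjoint collections F₁, …, F_r of vertex-disjoint directed cycles in D such that each F_i covers all but at most cL of the vertices of D. -/
open scoped Classical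

/-- A matrix of naturals with all row and column sums equal to `r` dominates the sum of `r`
permutation matrices. -/
lemma exists_perms_of_regular {V : Type*} [Fintype V] (r : ℕ) (A : V → V → ℕ)
    (hrow : ∀ u, ∑ v, A u v = r) (hcol : ∀ v, ∑ u, A u v = r) :
    ∃ F : Fin r → Equiv.Perm V, ∀ u v : V,
      (Finset.univ.filter fun i : Fin r => F i u = v).card ≤ A u v := by
  induction r generalizing A with
  | zero => exact ⟨fun i => i.elim0, fun u v => by simp⟩
  | succ r ih =>
    have hall : ∀ s : Finset V,
        s.card ≤ (s.biUnion fun u => Finset.univ.filter fun v => 0 < A u v).card := by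
      intro s
      set N := s.biUnion fun u => Finset.univ.filter fun v => 0 < A u v with hN
      have h1 : (r + 1) * s.card = ∑ u ∈ s, ∑ v ∈ N, A u v := by
        rw [mul_comm, ← smul_eq_mul, ← Finset.sum_const]
        refine Finset.sum_congr rfl fun u hu => ?_
        rw [← hrow u]
        refine (Finset.sum_subset (Finset.subset_univ _) fun v _ hv => ?_).symm
        by_contra h0
        exact hv (Finset.mem_biUnion.2 ⟨u, hu, by simpa [Nat.pos_iff_ne_zero] using h0⟩)
      have h2 : ∑ u ∈ s, ∑ v ∈ N, A u v ≤ (r + 1) * N.card := by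
        rw [Finset.sum_comm, mul_comm, ← smul_eq_mul, ← Finset.sum_const]
        refine Finset.sum_le_sum fun v _ => ?_
        rw [← hcol v]
        exact Finset.sum_le_sum_of_subset (Finset.subset_univ _)
      exact Nat.le_of_mul_le_mul_left (h1.trans_le h2) (Nat.succ_pos r)
    obtain ⟨f, hf, hfA⟩ := (Finset.all_card_le_biUnion_card_iff_exists_injective _).1 hall
    simp only [Finset.mem_filter, Finset.mem_univ, true_and] at hfA
    let e : Equiv.Perm V := Equiv.ofBijective f (Finite.injective_iff_bijective.1 hf)
    have he : ∀ u, e u = f u := fun u => rfl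
    have hle : ∀ u v, (if e u = v then 1 else 0) ≤ A u v := by
      intro u v
      split_ifs with h
      · rw [← h]; exact hfA u
      · exact Nat.zero_le _
    have hadd : ∀ u v, (A u v - if e u = v then 1 else 0) + (if e u = v then 1 else 0) = A u v :=
      fun u v => Nat.sub_add_cancel (hle u v)
    obtain ⟨F, hF⟩ := ih (fun u v => A u v - if e u = v then 1 else 0)
      (fun u => by
        have : ∑ v, ((A u v - if e u = v then 1 else 0) + if e u = v then 1 else 0) = r + 1 := by
          simp only [hadd, hrow]
        rw [Finset.sum_add_distrib] at this
        simpa using this)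
      (fun v => by
        have : ∑ u, ((A u v - if e u = v then 1 else 0) + if e u = v then 1 else 0) = r + 1 := by
          simp only [hadd, hcol]
        rw [Finset.sum_add_distrib] at this
        simpa [← Equiv.eq_symm_apply] using this)
    refine ⟨Fin.cons e F, fun u v => ?_⟩
    have hc := hF u v
    rw [Finset.card_filter] at hc ⊢
    rw [Fin.sum_univ_succ]
    simp only [Fin.cons_zero, Fin.cons_succ]
    have := hadd u v
    omega

/-- The Ore–Ryser condition gives a spanning `r`-regular submultigraph of a bipartite multigraph
with both vertex classes equal to `V`. -/
lemma exists_regular_le {V : Type*} [Fintype V] (r : ℕ) (D : V → V → ℕ)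
    (hD : ∀ S T : Finset V,
      r * (S.card + T.card) ≤ (∑ u ∈ S, ∑ v ∈ T, D u v) + r * Fintype.card V) :
    ∃ A : V → V → ℕ, (∀ u v, A u v ≤ D u v) ∧ (∀ u, ∑ v, A u v = r) ∧
      ∀ v, ∑ u, A u v = r := by
  let E := Σ p : V × V, Fin (D p.1 p.2)
  -- Apply Hall's theorem to the graph in which every edge is subdivided twice.
  let t : (V × Fin r) ⊕ E → Finset (E ⊕ (V × Fin r)) := fun x =>
    Sum.elim (fun a => Finset.univ.filter fun y => ∃ e : E, e.1.1 = a.1 ∧ y = Sum.inl e)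
      (fun e => Finset.univ.filter fun y => y = Sum.inl e ∨ ∃ j, y = Sum.inr (e.1.2, j)) x
  have hcard : ∀ S T : Finset V,
      (Finset.univ.filter fun e : E => e.1.1 ∈ S ∧ e.1.2 ∈ T).card = ∑ u ∈ S, ∑ v ∈ T, D u v := by
    intro S T
    have h : (Finset.univ.filter fun e : E => e.1.1 ∈ S ∧ e.1.2 ∈ T) =
        (S ×ˢ T).sigma fun p => (Finset.univ : Finset (Fin (D p.1 p.2))) := by
      ext e
      rw [Finset.mem_sigma, Finset.mem_product]
      simp
    rw [h, Finset.card_sigma, Finset.sum_product]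
    simp
  have hall : ∀ s : Finset ((V × Fin r) ⊕ E), s.card ≤ (s.biUnion t).card := by
    intro s
    let S : Finset V := Finset.univ.filter fun x => ∃ j, Sum.inl (x, j) ∈ s
    let E' : Finset E := Finset.univ.filter fun e => Sum.inr e ∈ s
    let Y : Finset V := E'.image fun e => e.1.2
    let ES : Finset E := Finset.univ.filter fun e => e.1.1 ∈ S ∧ e.1.2 ∈ Yᶜ
    have hdisj : Disjoint E' ES := by
      rw [Finset.disjoint_left]
      intro e he he'
      have h2 := (Finset.mem_filter.1 he').2.2
      exact (Finset.mem_compl.1 h2) (Finset.mem_image_of_mem _ he)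
    have h1 : s ⊆ (S ×ˢ Finset.univ).disjSum E' := by
      rintro (⟨x, j⟩ | e) hx
      · simpa [S] using ⟨j, hx⟩
      · simpa [E'] using hx
    have h2 : (E' ∪ ES).disjSum (Y ×ˢ Finset.univ) ⊆ s.biUnion t := by
      rintro (e | ⟨y, j⟩) hx
      · rw [Finset.inl_mem_disjSum, Finset.mem_union] at hx
        rw [Finset.mem_biUnion]
        rcases hx with hx | hx
        · exact ⟨Sum.inr e, (Finset.mem_filter.1 hx).2, by simp [t]⟩
        · obtain ⟨j, hj⟩ := (Finset.mem_filter.1 (Finset.mem_filter.1 hx).2.1).2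
          exact ⟨_, hj, by simp [t]⟩
      · rw [Finset.inr_mem_disjSum, Finset.mem_product] at hx
        obtain ⟨e, he, hey⟩ := Finset.mem_image.1 hx.1
        rw [Finset.mem_biUnion]
        exact ⟨Sum.inr e, (Finset.mem_filter.1 he).2, by simpa [t] using hey.symm⟩
    have h1' := Finset.card_le_card h1
    have h2' := Finset.card_le_card h2
    have h3 := hD S Yᶜ
    have h4 : ES.card = _ := hcard S Yᶜ
    rw [Finset.card_disjSum, Finset.card_product, Finset.card_univ, Fintype.card_fin] at h1' h2'
    rw [Finset.card_union_of_disjoint hdisj] at h2'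
    have h5 := Finset.card_add_card_compl Y
    rw [← h4, ← h5] at h3
    nlinarith
  obtain ⟨f, hf, hft⟩ := (Finset.all_card_le_biUnion_card_iff_exists_injective t).1 hall
  let P : E → Prop := fun e => f (Sum.inr e) ≠ Sum.inl e
  let A : V → V → ℕ := fun u v =>
    (Finset.univ.filter fun k : Fin (D u v) => P ⟨(u, v), k⟩).card
  have hAcard : ∀ S T : Finset V,
      (Finset.univ.filter fun e : E => (e.1.1 ∈ S ∧ e.1.2 ∈ T) ∧ P e).card
        = ∑ u ∈ S, ∑ v ∈ T, A u v := by
    intro S T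
    have h : (Finset.univ.filter fun e : E => (e.1.1 ∈ S ∧ e.1.2 ∈ T) ∧ P e) =
        (S ×ˢ T).sigma fun p => Finset.univ.filter fun k : Fin (D p.1 p.2) => P ⟨p, k⟩ := by
      ext e
      rw [Finset.mem_sigma, Finset.mem_product]
      simp
    rw [h, Finset.card_sigma, Finset.sum_product]
  have hrow : ∀ u, r ≤ ∑ v, A u v := by
    intro u
    have h := hAcard {u} Finset.univ
    rw [Finset.sum_singleton] at h
    rw [← h]
    have hex : ∀ j : Fin r, ∃ e : E, e.1.1 = u ∧ f (Sum.inl (u, j)) = Sum.inl e := by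
      intro j
      simpa [t] using hft (Sum.inl (u, j))
    choose g hg1 hg2 using hex
    have hg : Function.Injective g := by
      intro j k hjk
      have := hf ((hg2 j).trans (hjk ▸ (hg2 k).symm))
      simpa using this
    calc r = (Finset.univ.image g).card := by
          rw [Finset.card_image_of_injective _ hg, Finset.card_univ, Fintype.card_fin]
      _ ≤ _ := by
          refine Finset.card_le_card fun e he => ?_
          obtain ⟨j, -, rfl⟩ := Finset.mem_image.1 he
          refine Finset.mem_filter.2 ⟨Finset.mem_univ _, ⟨by simp [hg1], Finset.mem_univ _⟩, ?_⟩
          intro hP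
          simpa using hf (hP.trans (hg2 j).symm)
  have hcol : ∀ v, ∑ u, A u v ≤ r := by
    intro v
    have h := hAcard Finset.univ {v}
    simp only [Finset.sum_singleton] at h
    rw [← h]
    have hsub : ((Finset.univ.filter fun e : E =>
        (e.1.1 ∈ Finset.univ ∧ e.1.2 ∈ ({v} : Finset V)) ∧ P e).image fun e => f (Sum.inr e)) ⊆
        (Finset.univ : Finset (Fin r)).image fun j => Sum.inr (v, j) := by
      intro y hy
      obtain ⟨e, he, rfl⟩ := Finset.mem_image.1 hy
      obtain ⟨-, ⟨-, hev⟩, hP⟩ := Finset.mem_filter.1 he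
      have := hft (Sum.inr e)
      simp only [t, Sum.elim_inr, Finset.mem_filter, Finset.mem_univ, true_and] at this
      obtain ⟨j, hj⟩ := this.resolve_left hP
      rw [Finset.mem_singleton] at hev
      exact Finset.mem_image.2 ⟨j, Finset.mem_univ _, by rw [hj, hev]⟩
    have h1 := (Finset.card_le_card hsub).trans Finset.card_image_le
    rwa [Finset.card_image_of_injective _ fun _ _ h' => Sum.inr_injective (hf h'), Finset.card_univ,
      Fintype.card_fin] at h1
  have hsum : ∑ u, ∑ v, A u v = ∑ v, ∑ u, A u v := Finset.sum_comm
  have hlow : ∑ _u : V, r ≤ ∑ u, ∑ v, A u v := Finset.sum_le_sum fun u _ => hrow u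
  have hupp : ∑ v, ∑ u, A u v ≤ ∑ _v : V, r := Finset.sum_le_sum fun v _ => hcol v
  refine ⟨A, fun u v => (Finset.card_filter_le _ _).trans (by simp), fun u => ?_, fun v => ?_⟩
  · exact ((Finset.sum_eq_sum_iff_of_le fun u _ => hrow u).1
      (le_antisymm hlow (hsum.trans_le hupp)) u (Finset.mem_univ u)).symm
  · exact (Finset.sum_eq_sum_iff_of_le fun v _ => hcol v).1
      (le_antisymm hupp (hlow.trans_eq hsum)) v (Finset.mem_univ v)

/-- If every column sum of `D` is at least `lo` and every entry is at most `M`, then the edges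
from `S` to `T` number at least `|T| (lo - |Sᶜ| M)`. -/
lemma le_edges_of_inDeg {V : Type*} [Fintype V] (D : V → V → ℝ) (M lo : ℝ)
    (hM : ∀ u v, D u v ≤ M) (hin : ∀ v, lo ≤ ∑ u, D u v) (S T : Finset V) :
    T.card * (lo - (Sᶜ).card * M) ≤ ∑ u ∈ S, ∑ v ∈ T, D u v := by
  rw [Finset.sum_comm, ← nsmul_eq_mul]
  refine Finset.card_nsmul_le_sum _ _ _ fun v _ => ?_
  have h1 := Finset.sum_add_sum_compl S fun u => D u v
  have h2 : ∑ u ∈ Sᶜ, D u v ≤ (Sᶜ).card * M := by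
    rw [← nsmul_eq_mul]
    exact Finset.sum_le_card_nsmul _ _ _ fun u _ => hM u v
  linarith [hin v]

lemma le_edges_of_outDeg_of_inDeg {V : Type*} [Fintype V] (D : V → V → ℝ) (lo hi : ℝ)
    (h0 : ∀ u v, 0 ≤ D u v) (hout : ∀ u, lo ≤ ∑ v, D u v) (hin : ∀ v, ∑ u, D u v ≤ hi)
    (S T : Finset V) :
    S.card * lo - (Tᶜ).card * hi ≤ ∑ u ∈ S, ∑ v ∈ T, D u v := by
  have h1 : S.card * lo ≤ ∑ u ∈ S, ∑ v, D u v := by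
    rw [← nsmul_eq_mul]
    exact Finset.card_nsmul_le_sum _ _ _ fun u _ => hout u
  have h2 : ∑ u ∈ S, ∑ v ∈ Tᶜ, D u v ≤ (Tᶜ).card * hi := by
    rw [Finset.sum_comm, ← nsmul_eq_mul]
    refine Finset.sum_le_card_nsmul _ _ _ fun v _ => le_trans ?_ (hin v)
    exact Finset.sum_le_sum_of_subset_of_nonneg (Finset.subset_univ _) fun u _ _ => h0 u v
  have h3 : ∑ u ∈ S, ∑ v, D u v = ∑ u ∈ S, ∑ v ∈ T, D u v + ∑ u ∈ S, ∑ v ∈ Tᶜ, D u v := by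
    rw [← Finset.sum_add_distrib]
    exact Finset.sum_congr rfl fun u _ => (Finset.sum_add_sum_compl T _).symm
  linarith

/-- A lower bound on the number of edges from `S` to `T` that uses that the edges between two
vertices number at most `M` in total over both directions. -/
lemma le_two_mul_edges {V : Type*} [Fintype V] (D : V → V → ℝ) (M lo : ℝ)
    (h0 : ∀ u v, 0 ≤ D u v) (hM : ∀ u v, D u v + D v u ≤ M)
    (hout : ∀ u, lo ≤ ∑ v, D u v) (hin : ∀ v, lo ≤ ∑ u, D u v) (S T : Finset V) :
    lo * (S.card + T.card) - M / 2 * ((Fintype.card V : ℝ) ^ 2 - ((S ∩ T).card : ℝ) ^ 2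
      - ((Sᶜ ∩ Tᶜ).card : ℝ) ^ 2 - 2 * ((S ∩ Tᶜ).card * (Sᶜ ∩ T).card)) ≤
      2 * ∑ u ∈ S, ∑ v ∈ T, D u v := by
  let χ : Finset V → V → ℝ := fun X x => if x ∈ X then 1 else 0
  have hχ : ∀ X : Finset V, ∑ x, χ X x = X.card := fun X => by simp [χ]
  let z : V → V → ℝ := fun u v => χ (S ∩ T) u * χ (S ∩ T) v + χ (Sᶜ ∩ Tᶜ) u * χ (Sᶜ ∩ Tᶜ) v
    + χ (S ∩ Tᶜ) u * χ (Sᶜ ∩ T) v + χ (Sᶜ ∩ T) u * χ (S ∩ Tᶜ) v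
  have hzsum : ∑ u, ∑ v, (1 - z u v) = (Fintype.card V : ℝ) ^ 2 - ((S ∩ T).card : ℝ) ^ 2
      - ((Sᶜ ∩ Tᶜ).card : ℝ) ^ 2 - 2 * ((S ∩ Tᶜ).card * (Sᶜ ∩ T).card) := by
    simp only [z, Finset.sum_sub_distrib, Finset.sum_add_distrib, ← Finset.mul_sum,
      ← Finset.sum_mul, hχ]
    simp
    ring
  have hzsymm : ∀ u v, z u v = z v u := fun u v => by simp only [z]; ring
  have hz : ∀ u v, 0 ≤ 1 - z u v ∧ χ S u + χ T v - 2 * (χ S u * χ T v) ≤ 1 - z u v := by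
    intro u v
    by_cases h1 : u ∈ S <;> by_cases h2 : u ∈ T <;> by_cases h3 : v ∈ S <;>
      by_cases h4 : v ∈ T <;> simp [z, χ, h1, h2, h3, h4] <;> norm_num
  have hw : ∑ u, ∑ v, D u v * (χ S u + χ T v - 2 * (χ S u * χ T v)) =
      ∑ u ∈ S, ∑ v, D u v + ∑ v ∈ T, ∑ u, D u v - 2 * ∑ u ∈ S, ∑ v ∈ T, D u v := by
    have e1 : ∑ u ∈ S, ∑ v, D u v = ∑ u, ∑ v, D u v * χ S u := by
      simp [χ, Finset.sum_ite_mem]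
    have e2 : ∑ v ∈ T, ∑ u, D u v = ∑ u, ∑ v, D u v * χ T v := by
      rw [Finset.sum_comm (s := Finset.univ)]
      simp [χ, Finset.sum_ite_mem]
    have e3 : ∑ u ∈ S, ∑ v ∈ T, D u v = ∑ u, ∑ v, D u v * (χ S u * χ T v) := by
      simp only [mul_left_comm _ (χ S _), ← Finset.mul_sum]
      simp [χ]
    rw [e1, e2, e3, Finset.mul_sum, ← Finset.sum_add_distrib, ← Finset.sum_sub_distrib]
    refine Finset.sum_congr rfl fun u _ => ?_
    rw [Finset.mul_sum, ← Finset.sum_add_distrib, ← Finset.sum_sub_distrib]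
    exact Finset.sum_congr rfl fun v _ => by ring
  have hle : ∑ u, ∑ v, D u v * (χ S u + χ T v - 2 * (χ S u * χ T v)) ≤
      ∑ u, ∑ v, D u v * (1 - z u v) :=
    Finset.sum_le_sum fun u _ => Finset.sum_le_sum fun v _ =>
      mul_le_mul_of_nonneg_left (hz u v).2 (h0 u v)
  have hswap : ∑ u, ∑ v, D u v * (1 - z u v) = ∑ u, ∑ v, D v u * (1 - z u v) := by
    rw [Finset.sum_comm]
    exact Finset.sum_congr rfl fun u _ => Finset.sum_congr rfl fun v _ => by rw [hzsymm]
  have hdouble : ∑ u, ∑ v, D u v * (1 - z u v) + ∑ u, ∑ v, D v u * (1 - z u v) ≤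
      M * ∑ u, ∑ v, (1 - z u v) := by
    rw [Finset.mul_sum, ← Finset.sum_add_distrib]
    refine Finset.sum_le_sum fun u _ => ?_
    rw [Finset.mul_sum, ← Finset.sum_add_distrib]
    refine Finset.sum_le_sum fun v _ => ?_
    rw [← add_mul]
    exact mul_le_mul_of_nonneg_right (hM u v) (hz u v).1
  have hS : S.card * lo ≤ ∑ u ∈ S, ∑ v, D u v := by
    rw [← nsmul_eq_mul]
    exact Finset.card_nsmul_le_sum _ _ _ fun u _ => hout u
  have hT : T.card * lo ≤ ∑ v ∈ T, ∑ u, D u v := by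
    rw [← nsmul_eq_mul]
    exact Finset.card_nsmul_le_sum _ _ _ fun v _ => hin v
  rw [← hzsum]
  linarith

/-- The numerical inequality behind the Ore–Ryser condition when `|S| + |T| - n` is small; here `i`,
`a`, `b`, `ρ` stand for the sizes of `S ∩ T`, `S \ T`, `T \ S` and `Sᶜ ∩ Tᶜ`, while `x = |S|` and
`y = |T|`. -/
lemma le_of_intersections_large {c d η n i a b ρ x y : ℝ} (hc : 0 < c) (hc1 : c ≤ 1 / 8)
    (hd : 0 ≤ d) (hdc : d ≤ c ^ 3 / 1000) (hηd : η ≤ d) (n0 : 0 ≤ n) (a0 : 0 ≤ a)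
    (b0 : 0 ≤ b) (r0 : 0 ≤ ρ) (hp : (c - 4 * d) * n ≤ b + ρ) (hq : (c - 4 * d) * n ≤ a + ρ)
    (hx : x ≤ n) (hy : y ≤ n) (hs0 : 0 ≤ x + y - n)
    (hs : c * (x + y - n) ≤ (4 * d + 2 * η) * n) :
    2 * ((1 / 2 - c) * n * (x + y - n)) ≤ (1 / 2 - 4 * d) * n * (x + y)
      - 1 / 2 * (n ^ 2 - i ^ 2 - ρ ^ 2 - 2 * (a * b)) := by
  have c3 : c ^ 3 ≤ c ^ 2 / 8 := by
    calc c ^ 3 = c ^ 2 * c := by ring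
      _ ≤ c ^ 2 * (1 / 8) := mul_le_mul_of_nonneg_left hc1 (sq_nonneg c)
      _ = c ^ 2 / 8 := by ring
  have c2 : c ^ 2 ≤ c / 8 := by nlinarith
  have hd8 : 8 * d ≤ c ^ 2 / 1000 := by linarith
  have hs' : x + y - n ≤ 6 * (c ^ 2 / 1000) * n := by
    refine le_of_mul_le_mul_left ?_ hc
    calc c * (x + y - n) ≤ (4 * d + 2 * η) * n := hs
      _ ≤ 6 * (c ^ 3 / 1000) * n := mul_le_mul_of_nonneg_right (by linarith) n0
      _ = c * (6 * (c ^ 2 / 1000) * n) := by ring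
  have hlow : c / 2 * n ≤ (c - 4 * d) * n := mul_le_mul_of_nonneg_right (by linarith) n0
  have cn0 : 0 ≤ c / 4 * n := by positivity
  have hmain : c ^ 2 * n ^ 2 / 32 ≤ (i ^ 2 + ρ ^ 2) / 2 + a * b := by
    rcases le_or_gt (c / 4 * n) ρ with hρ | hρ
    · nlinarith [mul_le_mul hρ hρ cn0 r0, mul_nonneg a0 b0, sq_nonneg i]
    · have ha : c / 4 * n ≤ a := by linarith
      have hb : c / 4 * n ≤ b := by linarith
      nlinarith [mul_le_mul ha hb cn0 a0, sq_nonneg i, sq_nonneg ρ]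
  have t1 : n * (x + y - n) ≤ n * (6 * (c ^ 2 / 1000) * n) := mul_le_mul_of_nonneg_left hs' n0
  have t2 : 4 * d * n * (x + y) ≤ c ^ 2 / 1000 * n ^ 2 := by
    calc 4 * d * n * (x + y) ≤ 4 * d * n * (2 * n) :=
          mul_le_mul_of_nonneg_left (by linarith) (by positivity)
      _ = 8 * d * n ^ 2 := by ring
      _ ≤ c ^ 2 / 1000 * n ^ 2 := mul_le_mul_of_nonneg_right hd8 (sq_nonneg n)
  have t3 : 0 ≤ c * (n * (x + y - n)) := mul_nonneg hc.le (mul_nonneg n0 hs0)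
  have t4 : 0 ≤ c ^ 2 * n ^ 2 := by positivity
  linarith

/-- The Ore–Ryser condition for almost regular multidigraphs of degree about `n M / 2`. -/
lemma ore_ryser_of_almost_regular {V : Type*} [Fintype V] (D : V → V → ℝ) (M c d η : ℝ)
    (hM0 : 0 ≤ M) (hc : 0 < c) (hc1 : c ≤ 1 / 8) (hd : 0 < d) (hdc : d ≤ c ^ 3 / 1000)
    (hη : 0 < η) (hηd : η ≤ d)
    (h0 : ∀ u v, 0 ≤ D u v) (hM : ∀ u v, D u v + D v u ≤ M)
    (hout : ∀ u, (1 / 2 - 4 * d) * Fintype.card V * M ≤ ∑ v, D u v)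
    (hin : ∀ v, (1 / 2 - 4 * d) * Fintype.card V * M ≤ ∑ u, D u v)
    (hin' : ∀ v, ∑ u, D u v ≤ (1 / 2 + 2 * η) * Fintype.card V * M)
    (S T : Finset V) (hST : (Fintype.card V : ℝ) ≤ S.card + T.card) :
    (1 / 2 - c) * Fintype.card V * M * (S.card + T.card - Fintype.card V) ≤
      ∑ u ∈ S, ∑ v ∈ T, D u v := by
  have hM' : ∀ u v, D u v ≤ M := fun u v => by linarith [h0 v u, hM u v]
  have b1 := le_edges_of_inDeg D M _ hM' hin S T
  have b2 := le_edges_of_inDeg (fun u v => D v u) M _ (fun u v => hM' v u) hout T S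
  rw [Finset.sum_comm] at b2
  have b3 := le_edges_of_outDeg_of_inDeg D _ _ h0 hout hin' S T
  have b4 := le_two_mul_edges D M _ h0 hM hout hin S T
  set e := ∑ u ∈ S, ∑ v ∈ T, D u v
  have k1 : ((S ∩ T).card : ℝ) + (S ∩ Tᶜ).card = S.card := by
    rw [← Finset.sdiff_eq_inter_compl]
    exact_mod_cast Finset.card_inter_add_card_sdiff S T
  have k2 : ((S ∩ T).card : ℝ) + (Sᶜ ∩ T).card = T.card := by
    rw [Finset.inter_comm S T, Finset.inter_comm Sᶜ T, ← Finset.sdiff_eq_inter_compl]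
    exact_mod_cast Finset.card_inter_add_card_sdiff T S
  have k3 : (S.card : ℝ) + (Sᶜ).card = Fintype.card V := by
    exact_mod_cast Finset.card_add_card_compl S
  have k4 : (T.card : ℝ) + (Tᶜ).card = Fintype.card V := by
    exact_mod_cast Finset.card_add_card_compl T
  have k5 : ((Sᶜ ∩ T).card : ℝ) + (Sᶜ ∩ Tᶜ).card = (Sᶜ).card := by
    rw [← Finset.sdiff_eq_inter_compl]
    exact_mod_cast Finset.card_inter_add_card_sdiff Sᶜ T
  have a0 : (0 : ℝ) ≤ (S ∩ Tᶜ).card := Nat.cast_nonneg _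
  have bb0 : (0 : ℝ) ≤ (Sᶜ ∩ T).card := Nat.cast_nonneg _
  have r0 : (0 : ℝ) ≤ (Sᶜ ∩ Tᶜ).card := Nat.cast_nonneg _
  generalize ((S ∩ T).card : ℝ) = i at *
  generalize ((S ∩ Tᶜ).card : ℝ) = a at *
  generalize ((Sᶜ ∩ T).card : ℝ) = b at *
  generalize ((Sᶜ ∩ Tᶜ).card : ℝ) = ρ at *
  have p0 : (0 : ℝ) ≤ (Sᶜ).card := Nat.cast_nonneg _
  have q0 : (0 : ℝ) ≤ (Tᶜ).card := Nat.cast_nonneg _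
  have S0 : (0 : ℝ) ≤ S.card := Nat.cast_nonneg _
  have T0 : (0 : ℝ) ≤ T.card := Nat.cast_nonneg _
  have n0 : (0 : ℝ) ≤ Fintype.card V := Nat.cast_nonneg _
  generalize ((Sᶜ).card : ℝ) = p at *
  generalize ((Tᶜ).card : ℝ) = q at *
  generalize (S.card : ℝ) = x at *
  generalize (T.card : ℝ) = y at *
  generalize (Fintype.card V : ℝ) = n at *
  have hcc : c ^ 3 ≤ c / 64 := by nlinarith [mul_pos hc hc]
  have nM : 0 ≤ n * M := mul_nonneg n0 hM0
  have hs0 : 0 ≤ x + y - n := by linarith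
  have hk : 0 ≤ (1 / 2 - c) * n * M := by
    rw [mul_assoc]; exact mul_nonneg (by linarith) nM
  rcases le_or_gt p ((c - 4 * d) * n) with hp | hp
  · have h1 : (1 / 2 - c) * n * M ≤ (1 / 2 - 4 * d) * n * M - p * M := by
      nlinarith [mul_le_mul_of_nonneg_right hp hM0]
    calc _ ≤ (1 / 2 - c) * n * M * y := mul_le_mul_of_nonneg_left (by linarith) hk
      _ ≤ ((1 / 2 - 4 * d) * n * M - p * M) * y := mul_le_mul_of_nonneg_right h1 T0
      _ ≤ e := by linarith
  rcases le_or_gt q ((c - 4 * d) * n) with hq | hq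
  · have h1 : (1 / 2 - c) * n * M ≤ (1 / 2 - 4 * d) * n * M - q * M := by
      nlinarith [mul_le_mul_of_nonneg_right hq hM0]
    calc _ ≤ (1 / 2 - c) * n * M * x := mul_le_mul_of_nonneg_left (by linarith) hk
      _ ≤ ((1 / 2 - 4 * d) * n * M - q * M) * x := mul_le_mul_of_nonneg_right h1 S0
      _ ≤ e := by linarith
  rcases le_or_gt ((4 * d + 2 * η) * n) (c * (x + y - n)) with hs | hs
  · have h1 : (1 / 2 - c) * (x + y - n) ≤ x * (1 / 2 - 4 * d) - q * (1 / 2 + 2 * η) := by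
      nlinarith [mul_nonneg hd.le (show 0 ≤ n - x by linarith),
        mul_nonneg hη.le (show 0 ≤ n - q by linarith)]
    have := mul_le_mul_of_nonneg_left h1 nM
    linarith
  · have := mul_le_mul_of_nonneg_left
      (le_of_intersections_large (i := i) hc hc1 hd.le hdc hηd n0 a0 bb0 r0 (by linarith) (by linarith)
        (by linarith) (by linarith) hs0 hs.le) hM0
    linarith

/-- an almost regular loopless multidigraph (degrees between `(1/2−4d)L/β` and
`(1/2+2η)L/β`, at most `1/β` edges between any pair of vertices) contains `r = (1/2−c)L/β`
pairwise edge-disjoint collections of vertex-disjoint cycles, each covering all but at most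
`cL` vertices.  A collection of vertex-disjoint cycles is encoded as a permutation `F i`
(its non-fixed points are the covered vertices, its edges are `v → F i v`);
edge-disjointness says that each edge `(u,v)` is used by at most `D u v` of the
collections. -/
theorem almost_one_factorization_of_reduced_multidigraph :
    ∃ c₀ : ℝ, 0 < c₀ ∧
    ∀ c : ℝ, 0 < c → c ≤ c₀ →
    ∃ d₀ : ℝ, 0 < d₀ ∧
    ∀ d : ℝ, 0 < d → d ≤ d₀ →
    ∃ η₀ : ℝ, 0 < η₀ ∧
    ∀ η : ℝ, 0 < η → η ≤ η₀ →
    ∃ β₀ : ℝ, 0 < β₀ ∧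
    ∀ β : ℝ, 0 < β → β ≤ β₀ →
    ∃ L₀ : ℕ, ∀ L : ℕ, L₀ ≤ L →
    ∀ (V : Type) [Fintype V] [DecidableEq V], Fintype.card V = L →
    ∀ D : V → V → ℕ,
      (∀ v, D v v = 0) →
      (∀ u v : V, u ≠ v → ((D u v + D v u : ℕ) : ℝ) ≤ 1/β) →
      (∀ v, (1/2 - 4*d) * (L : ℝ) / β ≤ (outDegM D v : ℝ) ∧
            (outDegM D v : ℝ) ≤ (1/2 + 2*η) * (L : ℝ) / β ∧
            (1/2 - 4*d) * (L : ℝ) / β ≤ (inDegM D v : ℝ) ∧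
            (inDegM D v : ℝ) ≤ (1/2 + 2*η) * (L : ℝ) / β) →
      ∃ r : ℕ, (1/2 - c) * (L : ℝ) / β ≤ (r : ℝ) ∧
      ∃ F : Fin r → Equiv.Perm V,
        (∀ i, ∀ v : V, (F i) v ≠ v → 1 ≤ D v ((F i) v)) ∧
        (∀ u v : V,
          (Finset.univ.filter fun i : Fin r => (F i) u = v ∧ (F i) u ≠ u).card ≤ D u v) ∧
        (∀ i, (1 - c) * (L : ℝ) ≤ ((F i).support.card : ℝ)) := by
  refine ⟨1 / 4, by norm_num, fun c hc hc1 => ⟨(c / 2) ^ 3 / 1000, by positivity,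
    fun d hd hdc => ⟨d, hd, fun η hη hηd => ⟨1, one_pos, fun β hβ hβ1 =>
    ⟨⌈2 / c⌉₊, fun L hL V _ _ hV D hloop hmult hdeg => ?_⟩⟩⟩⟩⟩
  have hM1 : 1 ≤ 1 / β := by rwa [le_div_iff₀ hβ, one_mul]
  set M := 1 / β with hMdef
  have hdiv : ∀ x : ℝ, x / β = x * M := fun x => by rw [hMdef]; ring
  simp only [hdiv, outDegM, inDegM, Nat.cast_sum] at hdeg ⊢
  have hcL : 2 ≤ c * L := by
    have : 2 / c ≤ (L : ℝ) := (Nat.le_ceil _).trans (by exact_mod_cast hL)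
    rwa [div_le_iff₀ hc, mul_comm] at this
  have hpos : 0 ≤ (1 / 2 - c) * L * M :=
    mul_nonneg (mul_nonneg (by linarith) (Nat.cast_nonneg L)) (by linarith)
  set r := ⌈(1 / 2 - c) * L * M⌉₊ with hr
  have hrle : (r : ℝ) ≤ (1 / 2 - c / 2) * L * M := by
    have h1 := (Nat.ceil_lt_add_one hpos).le
    nlinarith [mul_le_mul hcL hM1 zero_le_one (by linarith)]
  have hore : ∀ S T : Finset V,
      r * (S.card + T.card) ≤ (∑ u ∈ S, ∑ v ∈ T, D u v) + r * Fintype.card V := by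
    intro S T
    rcases le_total (S.card + T.card) (Fintype.card V) with h | h
    · exact (Nat.mul_le_mul_left r h).trans (Nat.le_add_left _ _)
    · have hST : (Fintype.card V : ℝ) ≤ S.card + T.card := by exact_mod_cast h
      have key := ore_ryser_of_almost_regular (fun u v => (D u v : ℝ)) M (c / 2) d η
        (by linarith) (by linarith) (by linarith) hd hdc hη hηd (fun u v => Nat.cast_nonneg _)
        (fun u v => by
          by_cases huv : u = v
          · subst huv; simp [hloop]; linarith
          · exact_mod_cast hmult u v huv)
        (fun u => by rw [hV]; exact (hdeg u).1) (fun v => by rw [hV]; exact (hdeg v).2.2.1)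
        (fun v => by rw [hV]; exact (hdeg v).2.2.2) S T hST
      have h2 : (r : ℝ) * (S.card + T.card - Fintype.card V) ≤ ∑ u ∈ S, ∑ v ∈ T, (D u v : ℝ) :=
        (mul_le_mul_of_nonneg_right (by rw [hV]; exact hrle) (by linarith)).trans key
      have h3 : (r : ℝ) * (S.card + T.card) ≤
          (∑ u ∈ S, ∑ v ∈ T, (D u v : ℝ)) + r * Fintype.card V := by linarith
      exact_mod_cast h3
  obtain ⟨A, hAD, hrow, hcol⟩ := exists_regular_le r D hore
  obtain ⟨F, hF⟩ := exists_perms_of_regular r A hrow hcol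
  have huse : ∀ i v, 1 ≤ D v (F i v) := fun i v =>
    (Finset.card_pos.2 ⟨i, by simp⟩).trans_le ((hF v (F i v)).trans (hAD _ _))
  have hfix : ∀ i v, F i v ≠ v := fun i v h => by
    have := huse i v
    rw [h, hloop] at this
    omega
  refine ⟨r, Nat.le_ceil _, F, fun i v _ => huse i v, fun u v => ?_, fun i => ?_⟩
  · refine le_trans (Finset.card_le_card fun i hi => ?_) ((hF u v).trans (hAD u v))
    simp only [Finset.mem_filter] at hi ⊢
    exact ⟨hi.1, hi.2.1⟩
  · have : (F i).support = Finset.univ := by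
      ext v; simp [hfix]
    rw [this, Finset.card_univ, hV]
    nlinarith
end

section
/- Suppose 0 < 1/m ≪ ε ≪ β ≪ α' ≪ α ≪ 1 (each parameter sufficiently small in terms of the ones to its right, and m sufficiently large). Let Γ be an (ε, β + ε)-super-regular bipartite graph with vertex classes U = {u₁, …, u_m} and V = {v₁, …, v_m}, and set τ := (1 − α)βm (assumed to be an integer). Suppose that for each i we are given non-negative integers x_i ≤ α'βm (associated with u_i) and y_i ≤ α'βm (associated with v_i) such that Σᵢ x_i = Σᵢ y_i. Then Γ contains a spanning subgraph Γ' in which the degree of u_i is exactly τ − x_i and the degree of v_i is exactly τ − y_i, for every i. -/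
open scoped Classical

/-- Number of edges of a bipartite graph `E ⊆ α × β` between `X ⊆ α` and `Y ⊆ β`. -/
noncomputable def eBip {α β : Type*} (E : Finset (α × β)) (X : Finset α) (Y : Finset β) : ℕ :=
  (E.filter fun e => e.1 ∈ X ∧ e.2 ∈ Y).card

/-- Density of a bipartite graph between `X` and `Y`. -/
noncomputable def densBip {α β : Type*} (E : Finset (α × β)) (X : Finset α) (Y : Finset β) : ℝ :=
  (eBip E X Y : ℝ) / ((X.card : ℝ) * (Y.card : ℝ))

/-- Degree of a vertex of the first class. -/
noncomputable def degL {α β : Type*} (E : Finset (α × β)) (a : α) : ℕ :=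
  (E.filter fun e => e.1 = a).card

/-- Degree of a vertex of the second class. -/
noncomputable def degR {α β : Type*} (E : Finset (α × β)) (b : β) : ℕ :=
  (E.filter fun e => e.2 = b).card

/-- `E` (with vertex classes the whole of `α` and `β`) is `(ε,d)`-super-regular. -/
def IsSuperRegularBip {α β : Type*} [Fintype α] [Fintype β] (E : Finset (α × β))
    (ε d : ℝ) : Prop :=
  (∀ X : Finset α, ∀ Y : Finset β,
      ε * (Fintype.card α : ℝ) ≤ (X.card : ℝ) → ε * (Fintype.card β : ℝ) ≤ (Y.card : ℝ) →
      d - ε ≤ densBip E X Y ∧ densBip E X Y ≤ d + ε) ∧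
  (∀ a : α, (d - ε) * (Fintype.card β : ℝ) ≤ (degL E a : ℝ) ∧
            (degL E a : ℝ) ≤ (d + ε) * (Fintype.card β : ℝ)) ∧
  (∀ b : β, (d - ε) * (Fintype.card α : ℝ) ≤ (degR E b : ℝ) ∧
            (degR E b : ℝ) ≤ (d + ε) * (Fintype.card α : ℝ))

open Finset in
lemma sum_degL {α β : Type*} [Fintype α] (E : Finset (α × β)) :
    ∑ a, degL E a = E.card :=
  (card_eq_sum_card_fiberwise fun _ _ => mem_coe.2 (mem_univ _)).symm

open Finset in
lemma sum_degR {α β : Type*} [Fintype β] (E : Finset (α × β)) :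
    ∑ b, degR E b = E.card :=
  (card_eq_sum_card_fiberwise fun _ _ => mem_coe.2 (mem_univ _)).symm

open Finset in
/-- A lower bound for the number of edges between `X` and `Y` from the degrees in `Y`. -/
lemma sum_degR_le_eBip_add {α β : Type*} [Fintype α] (E : Finset (α × β))
    (X : Finset α) (Y : Finset β) :
    ∑ b ∈ Y, degR E b ≤ eBip E X Y + Xᶜ.card * Y.card := by
  have h : ∑ b ∈ Y, degR E b = (E.filter fun e => e.2 ∈ Y).card := by
    rw [card_eq_sum_card_fiberwise (f := Prod.snd) (t := Y) (by intro e; simp)]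
    refine sum_congr rfl fun b hb => ?_
    unfold degR
    congr 1
    ext e
    simp only [mem_filter]
    grind
  rw [h, ← card_product]
  refine (card_le_card fun e he => ?_).trans (card_union_le _ _)
  simp only [mem_union, mem_filter, mem_product, mem_compl] at he ⊢
  tauto

open Finset in
/-- A lower bound for the number of edges between `X` and `Y` from the degrees in `X`. -/
lemma sum_degL_le_eBip_add {α β : Type*} [Fintype β] (E : Finset (α × β))
    (X : Finset α) (Y : Finset β) :
    ∑ a ∈ X, degL E a ≤ eBip E X Y + X.card * Yᶜ.card := by
  have h : ∑ a ∈ X, degL E a = (E.filter fun e => e.1 ∈ X).card := by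
    rw [card_eq_sum_card_fiberwise (f := Prod.fst) (t := X) (by intro e; simp)]
    refine sum_congr rfl fun b hb => ?_
    unfold degL
    congr 1
    ext e
    simp only [mem_filter]
    grind
  rw [h, ← card_product]
  refine (card_le_card fun e he => ?_).trans (card_union_le _ _)
  simp only [mem_union, mem_filter, mem_product, mem_compl] at he ⊢
  tauto

/-- The auxiliary graph whose saturating matchings encode subgraphs of `E` with degrees `f`, `g`:
an edge of `E` is either matched to itself or takes one of the `f a` slots at its left end,
and every one of the `g b` slots at `b` takes an edge ending in `b`. -/
noncomputable def factorGadget {α β : Type*} (E : Finset (α × β)) (f : α → ℕ) (g : β → ℕ) :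
    E ⊕ (Σ b, Fin (g b)) → Finset (E ⊕ (Σ a, Fin (f a)))
  | .inl e => {.inl e} ∪ Finset.univ.image fun i : Fin (f e.1.1) => .inr ⟨e.1.1, i⟩
  | .inr p => (Finset.univ.filter fun e : E => e.1.2 = p.1).image .inl

open Finset in
lemma factorGadget_hall {α β : Type*} [Fintype α] [Fintype β] (E : Finset (α × β))
    (f : α → ℕ) (g : β → ℕ)
    (hcut : ∀ (S : Finset α) (T : Finset β),
      ∑ b ∈ T, g b ≤ eBip E S T + ∑ a ∈ Sᶜ, f a)
    (A : Finset (E ⊕ (Σ b, Fin (g b)))) :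
    A.card ≤ (A.biUnion (factorGadget E f g)).card := by
  set F : Finset E := A.toLeft with hF
  set T : Finset β := A.toRight.image Sigma.fst with hT
  set R : Finset α := F.image fun e => e.1.1 with hR
  set D : Finset E := univ.filter fun e => e.1.1 ∈ Rᶜ ∧ e.1.2 ∈ T with hD
  have hA : A.card ≤ F.card + ∑ b ∈ T, g b := by
    rw [← card_toLeft_add_card_toRight]
    have : A.toRight ⊆ T.sigma fun b => (univ : Finset (Fin (g b))) := by
      intro p hp
      exact mem_sigma.2 ⟨mem_image_of_mem Sigma.fst hp, mem_univ _⟩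
    have := card_le_card this
    rw [card_sigma] at this
    simpa [hF] using this
  have hDcard : D.card = eBip E Rᶜ T := by
    unfold eBip
    refine card_bij (fun e _ => e.1) ?_ ?_ ?_
    · intro e he
      simpa [hD] using he
    · intro e _ e' _ h
      exact Subtype.ext h
    · intro e he
      rw [mem_filter] at he
      exact ⟨⟨e, he.1⟩, by simpa [hD] using he.2, rfl⟩
  have hdisj : Disjoint F D := by
    rw [disjoint_left]
    intro e he hd
    simp only [hD, mem_filter, mem_compl] at hd
    exact hd.2.1 (mem_image_of_mem _ he)
  have hN : (F ∪ D).disjSum (R.sigma fun a => (univ : Finset (Fin (f a)))) ⊆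
      A.biUnion (factorGadget E f g) := by
    intro v hv
    rw [mem_biUnion]
    rcases v with e | ⟨u, i⟩
    · rw [inl_mem_disjSum, mem_union] at hv
      rcases hv with h | h
      · exact ⟨.inl e, by simpa [hF] using h, by simp [factorGadget]⟩
      · simp only [hD, mem_filter] at h
        obtain ⟨p, hp, hpe⟩ := mem_image.1 h.2.2
        exact ⟨.inr p, by simpa using hp, by simp [factorGadget, hpe]⟩
    · rw [inr_mem_disjSum, mem_sigma] at hv
      obtain ⟨e, he, rfl⟩ := mem_image.1 hv.1
      exact ⟨.inl e, by simpa [hF] using he, by simp [factorGadget]⟩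
  have hNc := card_le_card hN
  rw [card_disjSum, card_union_of_disjoint hdisj, hDcard, card_sigma] at hNc
  have hc := hcut Rᶜ T
  rw [compl_compl] at hc
  simp only [card_univ, Fintype.card_fin] at hNc
  omega

open Finset in
/-- **Bipartite factor theorem** (Gale–Ryser, Ore): the cut condition is sufficient for the
existence of a subgraph with prescribed degrees. -/
theorem exists_subgraph_of_cut {α β : Type*} [Fintype α] [Fintype β] (E : Finset (α × β))
    (f : α → ℕ) (g : β → ℕ) (hfg : ∑ a, f a = ∑ b, g b)
    (hcut : ∀ (S : Finset α) (T : Finset β),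
      ∑ b ∈ T, g b ≤ eBip E S T + ∑ a ∈ Sᶜ, f a) :
    ∃ E' ⊆ E, (∀ a, degL E' a = f a) ∧ (∀ b, degR E' b = g b) := by
  obtain ⟨φ, hinj, hφ⟩ := (all_card_le_biUnion_card_iff_exists_injective
    (factorGadget E f g)).1 (factorGadget_hall E f g hcut)
  set E₁ : Finset E := univ.filter fun e => φ (.inl e) ≠ .inl e with hE₁
  set E' : Finset (α × β) := E₁.image Subtype.val with hE'
  have hleft (e : E) (he : e ∈ E₁) : ∃ i : Fin (f e.1.1), φ (.inl e) = .inr ⟨e.1.1, i⟩ := by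
    have h := hφ (.inl e)
    simp only [factorGadget, mem_union, mem_singleton, mem_image] at h
    rcases h with h | ⟨i, -, h⟩
    · exact absurd h (mem_filter.1 he).2
    · exact ⟨i, h.symm⟩
  have hright (p : Σ b, Fin (g b)) : ∃ e ∈ E₁, e.1.2 = p.1 ∧ φ (.inr p) = .inl e := by
    have h := hφ (.inr p)
    simp only [factorGadget, mem_image, mem_filter] at h
    obtain ⟨e, ⟨-, he⟩, h⟩ := h
    refine ⟨e, mem_filter.2 ⟨mem_univ _, fun h' => ?_⟩, he, h.symm⟩
    exact absurd (hinj (h'.trans h)) (by simp)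
  have hL (a : α) : degL E' a ≤ f a := by
    have hcard : degL E' a = (E₁.filter fun e => e.1.1 = a).card := by
      rw [degL, hE', filter_image, card_image_of_injective _ Subtype.val_injective]
    rw [hcard, ← Fintype.card_fin (f a), ← card_univ]
    refine (card_le_card_of_injOn (t := univ.image fun i : Fin (f a) => Sum.inr ⟨a, i⟩)
      (fun e => φ (.inl e)) ?_ (hinj.comp Sum.inl_injective).injOn).trans card_image_le
    intro e he
    obtain ⟨he₁, rfl⟩ := mem_filter.1 (mem_coe.1 he)
    obtain ⟨i, hi⟩ := hleft e he₁
    exact mem_coe.2 (mem_image.2 ⟨i, mem_univ _, hi.symm⟩)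
  have hR (b : β) : g b ≤ degR E' b := by
    choose ψ hψ using fun i : Fin (g b) => hright ⟨b, i⟩
    rw [← Fintype.card_fin (g b), ← card_univ, degR]
    refine card_le_card_of_injOn (fun i => (ψ i).1) ?_ ?_
    · intro i _
      exact mem_coe.2 (mem_filter.2 ⟨mem_image_of_mem _ (hψ i).1, (hψ i).2.1⟩)
    · intro i _ j _ h
      have h' : ψ i = ψ j := Subtype.ext h
      have := hinj ((hψ i).2.2.trans ((congrArg Sum.inl h').trans (hψ j).2.2.symm))
      simpa using this
  have hsL := sum_le_sum fun a (_ : a ∈ univ) => hL a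
  have hsR := sum_le_sum fun b (_ : b ∈ univ) => hR b
  have h1 := sum_degL E'
  have h2 := sum_degR E'
  refine ⟨E', ?_, fun a => ?_, fun b => ?_⟩
  · intro e he
    obtain ⟨e, -, rfl⟩ := mem_image.1 he
    exact e.2
  · exact (sum_eq_sum_iff_of_le fun a _ => hL a).1 (by omega) a (mem_univ _)
  · exact ((sum_eq_sum_iff_of_le fun b _ => hR b).1 (by omega) b (mem_univ _)).symm

/-- The cut inequality for a small side: `t` vertices demanding at most `(1 - a) D` each,
`c` vertices supplying at least `(1 - a - a') D` each, and `e` edges avoiding the supply. -/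
lemma small_cut_bound {a a' D δ t c e G F : ℝ} (ha : a ≤ 1 / 4) (ha' : a' ≤ 1 / 4)
    (hD : 0 ≤ D) (ht : 0 ≤ t) (he : 0 ≤ e) (htδ : t ≤ δ) (hδ : 2 * δ ≤ a * D)
    (hG : G ≤ (1 - a) * D * t) (hF : ((1 - a) * D - a' * D) * c ≤ F) (hc : 0 ≤ c)
    (hdeg : D * t ≤ e + c * t) : G ≤ e + F := by
  have hsup : 0 ≤ (1 - a - a' - 1 / 2) * D := mul_nonneg (by linarith) hD
  rcases le_total (2 * t) c with h | h
  · have h1 : ((1 - a) * D - a' * D) * (2 * t) ≤ ((1 - a) * D - a' * D) * c :=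
      mul_le_mul_of_nonneg_left h (by nlinarith)
    have h2 : 0 ≤ ((1 - a) - 2 * a') * D * t :=
      mul_nonneg (mul_nonneg (by linarith) hD) ht
    nlinarith
  · have h1 : c * t ≤ a * D * t := mul_le_mul_of_nonneg_right (by linarith) ht
    have h2 : 0 ≤ ((1 - a) * D - a' * D) * c := mul_nonneg (by nlinarith) hc
    nlinarith

/-- The cut inequality when both sides are large; `s`, `t` are proportions. -/
lemma dense_cut_bound {a a' s t : ℝ} (ha : 0 ≤ a) (ha4 : a ≤ 1 / 4) (ha'0 : 0 ≤ a')
    (ha'4 : a' ≤ 1 / 4) (haa : a' ≤ a) (hs : 0 ≤ s) (hs1 : s ≤ 1) (ht : 0 ≤ t) (ht1 : t ≤ 1) :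
    (1 - a) * s ≤ s * t + (1 - a - a') * (1 - t) ∨
      (1 - a) * t ≤ s * t + (1 - a - a') * (1 - s) := by
  rcases le_total s (1 - a - a') with h | h
  · left
    nlinarith [mul_nonneg (sub_nonneg.2 h) (sub_nonneg.2 ht1), mul_nonneg hs ha]
  rcases le_total t (1 - a - a') with h' | h'
  · right
    nlinarith [mul_nonneg (sub_nonneg.2 h') (sub_nonneg.2 hs1), mul_nonneg ht ha]
  left
  rcases le_total (1 - a) t with h2 | h2
  · nlinarith [mul_nonneg hs (sub_nonneg.2 h2),
      mul_nonneg (by linarith : 0 ≤ 1 - a - a') (sub_nonneg.2 ht1)]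
  · have h3 : s * (1 - a - t) ≤ 1 - a - t := mul_le_of_le_one_left (by linarith) hs1
    nlinarith [mul_le_mul_of_nonneg_right (by linarith : 1 / 2 ≤ t) (by linarith : 0 ≤ a + a')]

open Finset in
/-- The cut condition holds in a super-regular pair for almost regular degree sequences. -/
lemma IsSuperRegularBip.cut {U W : Type*} [Fintype U] [Fintype W] {E : Finset (U × W)}
    {a a' b ε : ℝ} {m : ℕ} (ha : 0 ≤ a) (ha4 : a ≤ 1 / 4) (ha'0 : 0 ≤ a')
    (ha'4 : a' ≤ 1 / 4) (haa : a' ≤ a) (hb : 0 ≤ b) (hε : 2 * ε ≤ a * b) (hm : 0 < m)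
    (hU : Fintype.card U = m) (hW : Fintype.card W = m)
    (hE : IsSuperRegularBip E ε (b + ε)) {f : U → ℕ} {g : W → ℕ}
    (hfg : ∑ u, f u = ∑ w, g w)
    (hf1 : ∀ u, (f u : ℝ) ≤ (1 - a) * (b * m))
    (hf2 : ∀ u, (1 - a) * (b * m) - a' * (b * m) ≤ (f u : ℝ))
    (hg1 : ∀ w, (g w : ℝ) ≤ (1 - a) * (b * m))
    (hg2 : ∀ w, (1 - a) * (b * m) - a' * (b * m) ≤ (g w : ℝ))
    (S : Finset U) (T : Finset W) :
    ∑ w ∈ T, g w ≤ eBip E S T + ∑ u ∈ Sᶜ, f u := by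
  obtain ⟨hreg, hdL, hdR⟩ := hE
  simp only [hU, hW, add_sub_cancel_right] at hreg hdL hdR
  have hm0 : (0 : ℝ) < m := by exact_mod_cast hm
  have hD : 0 ≤ b * m := by positivity
  have hδ : 2 * (ε * m) ≤ a * (b * m) := by nlinarith
  have htot : ((∑ u ∈ S, f u : ℕ) : ℝ) + (∑ u ∈ Sᶜ, f u : ℕ) =
      (∑ w ∈ T, g w : ℕ) + (∑ w ∈ Tᶜ, g w : ℕ) := by
    have h : ∑ u ∈ S, f u + ∑ u ∈ Sᶜ, f u = ∑ w ∈ T, g w + ∑ w ∈ Tᶜ, g w := by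
      rw [sum_add_sum_compl, sum_add_sum_compl, hfg]
    exact_mod_cast h
  have hFS : ((∑ u ∈ S, f u : ℕ) : ℝ) ≤ (1 - a) * (b * m) * S.card := by
    have := sum_le_card_nsmul S (fun u => (f u : ℝ)) _ fun u _ => hf1 u
    rw [nsmul_eq_mul, mul_comm] at this
    exact_mod_cast this
  have hGT : ((∑ w ∈ T, g w : ℕ) : ℝ) ≤ (1 - a) * (b * m) * T.card := by
    have := sum_le_card_nsmul T (fun w => (g w : ℝ)) _ fun w _ => hg1 w
    rw [nsmul_eq_mul, mul_comm] at this
    exact_mod_cast this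
  have hFS' : ((1 - a) * (b * m) - a' * (b * m)) * (Sᶜ.card : ℝ) ≤ (∑ u ∈ Sᶜ, f u : ℕ) := by
    have := card_nsmul_le_sum Sᶜ (fun u => (f u : ℝ)) _ fun u _ => hf2 u
    rw [nsmul_eq_mul, mul_comm] at this
    exact_mod_cast this
  have hGT' : ((1 - a) * (b * m) - a' * (b * m)) * (Tᶜ.card : ℝ) ≤ (∑ w ∈ Tᶜ, g w : ℕ) := by
    have := card_nsmul_le_sum Tᶜ (fun w => (g w : ℝ)) _ fun w _ => hg2 w
    rw [nsmul_eq_mul, mul_comm] at this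
    exact_mod_cast this
  have hdT : b * m * T.card ≤ (eBip E S T : ℝ) + Sᶜ.card * T.card := by
    have h1 := card_nsmul_le_sum T (fun w => (degR E w : ℝ)) _ fun w _ => (hdR w).1
    have h2 : ((∑ w ∈ T, degR E w : ℕ) : ℝ) ≤ (eBip E S T + Sᶜ.card * T.card : ℕ) :=
      Nat.cast_le.2 (sum_degR_le_eBip_add E S T)
    rw [nsmul_eq_mul, mul_comm] at h1
    push_cast at h2
    linarith
  have hdS : b * m * S.card ≤ (eBip E S T : ℝ) + Tᶜ.card * S.card := by
    have h1 := card_nsmul_le_sum S (fun u => (degL E u : ℝ)) _ fun u _ => (hdL u).1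
    have h2 : ((∑ u ∈ S, degL E u : ℕ) : ℝ) ≤ (eBip E S T + S.card * Tᶜ.card : ℕ) :=
      Nat.cast_le.2 (sum_degL_le_eBip_add E S T)
    rw [nsmul_eq_mul, mul_comm] at h1
    push_cast at h2
    linarith
  have he0 : (0 : ℝ) ≤ eBip E S T := Nat.cast_nonneg _
  suffices h : ((∑ w ∈ T, g w : ℕ) : ℝ) ≤ eBip E S T + (∑ u ∈ Sᶜ, f u : ℕ) by
    exact_mod_cast h
  rcases le_total (T.card : ℝ) (ε * m) with hT | hT
  · exact small_cut_bound ha4 ha'4 hD (Nat.cast_nonneg _) he0 hT hδ hGT hFS'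
      (Nat.cast_nonneg _) hdT
  rcases le_total (S.card : ℝ) (ε * m) with hS | hS
  · have := small_cut_bound ha4 ha'4 hD (Nat.cast_nonneg _) he0 hS hδ hFS hGT'
      (Nat.cast_nonneg _) hdS
    linarith
  have hedge : b * (S.card * T.card) ≤ (eBip E S T : ℝ) := by
    have h := (hreg S T hS hT).1
    unfold densBip at h
    rcases (by positivity : (0 : ℝ) ≤ S.card * T.card).eq_or_lt with h0 | h0
    · rw [← h0, mul_zero]
      exact he0
    · exact (le_div_iff₀ h0).1 h
  have hScard : (S.card : ℝ) + Sᶜ.card = m := by exact_mod_cast (card_add_card_compl S).trans hU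
  have hTcard : (T.card : ℝ) + Tᶜ.card = m := by exact_mod_cast (card_add_card_compl T).trans hW
  have hSm : (S.card : ℝ) = S.card / m * m := (div_mul_cancel₀ _ hm0.ne').symm
  have hTm : (T.card : ℝ) = T.card / m * m := (div_mul_cancel₀ _ hm0.ne').symm
  have hs0 : (0 : ℝ) ≤ S.card / m := div_nonneg (Nat.cast_nonneg _) hm0.le
  have ht0 : (0 : ℝ) ≤ T.card / m := div_nonneg (Nat.cast_nonneg _) hm0.le
  have hs1 : (S.card : ℝ) / m ≤ 1 := by
    rw [div_le_one hm0]
    linarith [(Nat.cast_nonneg _ : (0 : ℝ) ≤ (Sᶜ.card : ℝ))]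
  have ht1 : (T.card : ℝ) / m ≤ 1 := by
    rw [div_le_one hm0]
    linarith [(Nat.cast_nonneg _ : (0 : ℝ) ≤ (Tᶜ.card : ℝ))]
  set s : ℝ := S.card / m
  set t : ℝ := T.card / m
  have hSc : (Sᶜ.card : ℝ) = (1 - s) * m := by linarith
  have hTc : (Tᶜ.card : ℝ) = (1 - t) * m := by linarith
  rw [hSm, hTm] at hedge
  rw [hSm] at hFS
  rw [hTm] at hGT
  rw [hSc] at hFS'
  rw [hTc] at hGT'
  have hK : 0 ≤ b * m * m := by positivity
  rcases dense_cut_bound ha ha4 ha'0 ha'4 haa hs0 hs1 ht0 ht1 with h | h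
  · have := mul_le_mul_of_nonneg_left h hK
    linarith
  · have := mul_le_mul_of_nonneg_left h hK
    linarith

/-- in an `(ε, β+ε)`-super-regular pair one can find a spanning subgraph with
prescribed, almost regular, degree sequence `τ − xᵢ` / `τ − yᵢ`, where `τ = (1−α)βm`. -/
theorem spanning_subgraph_with_prescribed_degrees :
    ∃ a₀ : ℝ, 0 < a₀ ∧
    ∀ a : ℝ, 0 < a → a ≤ a₀ →
    ∃ a'₀ : ℝ, 0 < a'₀ ∧
    ∀ a' : ℝ, 0 < a' → a' ≤ a'₀ →
    ∃ β₀ : ℝ, 0 < β₀ ∧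
    ∀ β : ℝ, 0 < β → β ≤ β₀ →
    ∃ ε₀ : ℝ, 0 < ε₀ ∧
    ∀ ε : ℝ, 0 < ε → ε ≤ ε₀ →
    ∃ m₀ : ℕ, ∀ m : ℕ, m₀ ≤ m →
    ∀ (U W : Type) [Fintype U] [Fintype W] [DecidableEq U] [DecidableEq W],
      Fintype.card U = m → Fintype.card W = m →
    ∀ E : Finset (U × W),
      IsSuperRegularBip E ε (β + ε) →
    ∀ τ : ℕ, (τ : ℝ) = (1 - a) * β * (m : ℝ) →
    ∀ x : U → ℕ, ∀ y : W → ℕ,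
      (∀ u, (x u : ℝ) ≤ a' * β * (m : ℝ)) →
      (∀ w, (y w : ℝ) ≤ a' * β * (m : ℝ)) →
      (∑ u, x u) = (∑ w, y w) →
      ∃ E' ⊆ E, (∀ u, degL E' u = τ - x u) ∧ (∀ w, degR E' w = τ - y w) := by
  refine ⟨1 / 4, by norm_num, fun a ha ha4 => ⟨a, ha, fun a' ha' haa => ⟨1, one_pos,
    fun β hβ _ => ⟨a * β / 2, by positivity, fun ε _ hε => ⟨1, ?_⟩⟩⟩⟩⟩
  intro m hm U W _ _ _ _ hU hW E hE τ hτ x y hx hy hxy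
  have hD : 0 ≤ β * (m : ℝ) := by positivity
  have hτ' : (τ : ℝ) = (1 - a) * (β * m) := by rw [hτ, mul_assoc]
  have hle (n : ℕ) (hn : (n : ℝ) ≤ a' * β * m) : n ≤ τ := by
    have : (n : ℝ) ≤ τ := by
      nlinarith [mul_nonneg (by linarith : 0 ≤ 1 - a - a') hD]
    exact_mod_cast this
  have hxτ u := hle _ (hx u)
  have hyτ w := hle _ (hy w)
  have hsum : ∑ u, (τ - x u) = ∑ w, (τ - y w) := by
    rw [Finset.sum_tsub_distrib _ fun u _ => hxτ u, Finset.sum_tsub_distrib _ fun w _ => hyτ w, hxy]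
    simp [hU, hW]
  refine exists_subgraph_of_cut E _ _ hsum fun S T =>
    hE.cut ha.le ha4 ha'.le (haa.trans ha4) haa hβ.le (by linarith) hm hU hW hsum
      (fun u => ?_) (fun u => ?_) (fun w => ?_) (fun w => ?_) S T
  · rw [Nat.cast_sub (hxτ u), hτ']
    linarith [(Nat.cast_nonneg (x u) : (0 : ℝ) ≤ x u)]
  · rw [Nat.cast_sub (hxτ u), hτ']
    linarith [hx u]
  · rw [Nat.cast_sub (hyτ w), hτ']
    linarith [(Nat.cast_nonneg (y w) : (0 : ℝ) ≤ y w)]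
  · rw [Nat.cast_sub (hyτ w), hτ']
    linarith [hy w]
end

section
/- Suppose 0 < θ₁, θ₂, θ₃ < 1/2 and θ₁/θ₃ is sufficiently small in terms of θ₂. Let G be a ρ-regular oriented graph (every vertex has in- and outdegree exactly ρ) whose order n is sufficiently large, where ρ = θ₃n. Let A₁, …, A_{5n} be subsets of the vertex set of G with a_i := |A_i| ≥ n^{1/2} for each i, and let H be an oriented subgraph of G such that for each i every vertex x ∈ A_i satisfies d⁺_H(x) ≤ θ₁n and d⁻_H(x) ≤ θ₁n. Then G has a 1-factor F such that: (i) F consists of at most n/(log n)^{1/5} cycles; and (ii) for each i, at most θ₂·a_i edges lying both in H and in F are incident to a vertex of A_i. -/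
open scoped Classical

/-- Outdegree of a vertex in a digraph given as a relation. -/
noncomputable def outDeg {V : Type*} [Fintype V] (G : V → V → Prop) (v : V) : ℕ :=
  (Finset.univ.filter fun u => G v u).card

/-- Indegree of a vertex in a digraph given as a relation. -/
noncomputable def inDeg {V : Type*} [Fintype V] (G : V → V → Prop) (v : V) : ℕ :=
  (Finset.univ.filter fun u => G u v).card

/-- The permutations all of whose edges `v → σ v` satisfy `R`. -/
noncomputable def permsIn {V : Type*} [Fintype V] [DecidableEq V] (R : V → V → Prop) :
    Finset (Equiv.Perm V) :=
  Finset.univ.filter fun σ => ∀ v, R v (σ v)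

theorem mem_permsIn {V : Type*} [Fintype V] [DecidableEq V] {R : V → V → Prop}
    {σ : Equiv.Perm V} : σ ∈ permsIn R ↔ ∀ v, R v (σ v) := by
  simp [permsIn]

/-- `log (r!) / r`, the logarithm of the geometric mean of `1, …, r`. -/
noncomputable def logGeomFactorial (r : ℕ) : ℝ := Real.log (r.factorial) / r

theorem mul_logGeomFactorial (r : ℕ) : r * logGeomFactorial r = Real.log r.factorial := by
  unfold logGeomFactorial
  rcases Nat.eq_zero_or_pos r with rfl | h
  · simp
  · field_simp

theorem logGeomFactorial_one : logGeomFactorial 1 = 0 := by simp [logGeomFactorial]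

theorem logGeomFactorial_mono : Monotone logGeomFactorial := by
  refine monotone_nat_of_le_succ fun r => ?_
  rcases Nat.eq_zero_or_pos r with rfl | h
  · simp [logGeomFactorial]
  have hr : (0 : ℝ) < r := by exact_mod_cast h
  have h1 : Real.log r.factorial ≤ r * Real.log (r + 1) := by
    rw [← Real.log_pow]
    refine Real.log_le_log (by exact_mod_cast r.factorial_pos) ?_
    have : r.factorial ≤ (r + 1) ^ r :=
      (Nat.factorial_le_pow r).trans (Nat.pow_le_pow_left (by omega) r)
    exact_mod_cast this
  have h2 : Real.log (r + 1).factorial = Real.log (r + 1) + Real.log r.factorial := by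
    rw [Nat.factorial_succ]
    push_cast
    rw [Real.log_mul (by positivity) (by positivity)]
  unfold logGeomFactorial
  rw [h2, div_le_div_iff₀ hr (by positivity)]
  push_cast
  nlinarith

theorem logGeomFactorial_step {r : ℕ} (hr : 1 ≤ r) :
    Real.log r + (r - 1 : ℕ) * logGeomFactorial (r - 1) = r * logGeomFactorial r := by
  rw [mul_logGeomFactorial, mul_logGeomFactorial]
  obtain ⟨k, rfl⟩ : ∃ k, r = k + 1 := ⟨r - 1, by omega⟩
  rw [Nat.add_sub_cancel, Nat.factorial_succ]
  push_cast
  rw [Real.log_mul (by positivity) (by positivity)]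

/-- Jensen's inequality for `x log x`. -/
theorem sum_mul_log_sum_le {ι : Type*} (s : Finset ι) (t : ι → ℝ) (ht : ∀ i ∈ s, 0 ≤ t i)
    (hpos : 0 < ∑ i ∈ s, t i) :
    (∑ i ∈ s, t i) * Real.log (∑ i ∈ s, t i) ≤
      (∑ i ∈ s, t i) * Real.log s.card + ∑ i ∈ s, t i * Real.log (t i) := by
  have hs : 0 < s.card := by
    rw [Finset.card_pos]
    by_contra h
    rw [Finset.not_nonempty_iff_eq_empty] at h
    simp [h] at hpos
  have hs' : (0 : ℝ) < s.card := by exact_mod_cast hs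
  have := Real.convexOn_mul_log.map_sum_le (t := s) (w := fun _ => (s.card : ℝ)⁻¹) (p := t)
    (fun _ _ => by positivity) (by simp [hs'.ne']) (fun i hi => ht i hi)
  simp only [smul_eq_mul, ← Finset.mul_sum] at this
  rw [Real.log_mul (by positivity) hpos.ne', Real.log_inv] at this
  rw [mul_assoc, mul_le_mul_iff_right₀ (by positivity)] at this
  linarith

/-- Force the edge `i → k`: delete all other edges out of `i` and into `k`. -/
def forceEdge {V : Type*} (R : V → V → Prop) (i k : V) : V → V → Prop :=
  fun u v => R u v ∧ (u = i ↔ v = k)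

theorem mem_permsIn_forceEdge {V : Type*} [Fintype V] [DecidableEq V] {R : V → V → Prop}
    {i k : V} {σ : Equiv.Perm V} :
    σ ∈ permsIn (forceEdge R i k) ↔ σ ∈ permsIn R ∧ σ i = k := by
  simp only [mem_permsIn, forceEdge]
  constructor
  · exact fun h => ⟨fun v => (h v).1, (h i).2.1 rfl⟩
  · rintro ⟨h, rfl⟩
    exact fun v => ⟨h v, by simp⟩

section Bregman
open Finset
variable {V : Type*} [Fintype V] [DecidableEq V]

theorem outDeg_forceEdge_of_ne {R : V → V → Prop} {i j k : V} (h : j ≠ i) :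
    outDeg (forceEdge R i k) j = if R j k then outDeg R j - 1 else outDeg R j := by
  unfold outDeg
  split_ifs with hR
  · rw [← card_erase_of_mem (a := k) (by simpa using hR)]
    congr 1
    ext u
    simp [forceEdge, h, and_comm]
  · congr 1
    ext u
    simp only [forceEdge, h, mem_filter, mem_univ, true_and, false_iff]
    constructor
    · exact fun h => h.1
    · intro hu
      exact ⟨hu, by rintro rfl; exact hR hu⟩

/-- **Brègman's theorem**, relative to a set `U` of rows outside which the matrix is a partial
permutation matrix. -/
theorem log_card_permsIn_le_sum (U : Finset V) : ∀ R : V → V → Prop,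
    (∀ i ∉ U, ∀ k, R i k → (∀ k', R i k' → k' = k) ∧ ∀ j, R j k → j = i) →
    Real.log (permsIn R).card ≤ ∑ j ∈ U, logGeomFactorial (outDeg R j) := by
  induction U using Finset.strongInduction with
  | H U ih =>
  intro R hR
  have hnn : ∀ r, 0 ≤ logGeomFactorial r := fun r => by
    unfold logGeomFactorial
    have : (1 : ℝ) ≤ r.factorial := by exact_mod_cast r.factorial_pos
    exact div_nonneg (Real.log_nonneg this) (by positivity)
  rcases (permsIn R).eq_empty_or_nonempty with he | hne
  · rw [he]
    simpa using sum_nonneg fun j _ => hnn _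
  rcases U.eq_empty_or_nonempty with hU | hU
  · have : (permsIn R).card ≤ 1 := by
      rw [card_le_one]
      intro σ hσ τ hτ
      rw [mem_permsIn] at hσ hτ
      ext v
      exact (hR v (by simp [hU]) _ (hτ v)).1 _ (hσ v)
    have h1 : (permsIn R).card = 1 := le_antisymm this hne.card_pos
    simp [h1, hU]
  obtain ⟨P, hP⟩ : ∃ P : ℝ, P = (permsIn R).card := ⟨_, rfl⟩
  have hPpos : 0 < P := by
    rw [hP]
    exact_mod_cast hne.card_pos
  have hUpos : (0 : ℝ) < U.card := by exact_mod_cast hU.card_pos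
  obtain ⟨Q, hQ⟩ : ∃ Q : V → V → ℝ, ∀ i k, Q i k = (permsIn (forceEdge R i k)).card :=
    ⟨_, fun _ _ => rfl⟩
  have hQ0 : ∀ i k, 0 ≤ Q i k := fun i k => by
    rw [hQ]
    positivity
  have hfib : ∀ i (f : V → ℝ), ∑ k with R i k, Q i k * f k = ∑ σ ∈ permsIn R, f (σ i) := by
    intro i f
    have hmap : ∀ σ ∈ permsIn R, σ i ∈ univ.filter (fun k => R i k) := fun σ hσ => by
      simpa using mem_permsIn.1 hσ i
    rw [← sum_fiberwise_of_maps_to hmap]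
    refine sum_congr rfl fun k _ => ?_
    rw [sum_congr rfl (g := fun _ => f k) (fun σ hσ => by rw [(mem_filter.1 hσ).2])]
    rw [sum_const, nsmul_eq_mul, hQ]
    congr 2
    refine congrArg card ?_
    ext σ
    rw [mem_permsIn_forceEdge, mem_filter]
  have hrow : ∀ i, P * Real.log P ≤
      ∑ σ ∈ permsIn R, (Real.log (outDeg R i) + Real.log (Q i (σ i))) := by
    intro i
    have hsum : ∑ k with R i k, Q i k = P := by
      simpa [hP] using hfib i (fun _ => 1)
    have := sum_mul_log_sum_le (univ.filter fun k => R i k) (Q i) (fun _ _ => hQ0 _ _)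
      (by rw [hsum]; exact hPpos)
    rw [hsum, hfib i (fun k => Real.log (Q i k))] at this
    rw [sum_add_distrib, sum_const, nsmul_eq_mul, ← hP]
    exact this
  have hstep : ∀ σ ∈ permsIn R, ∀ i ∈ U, Real.log (Q i (σ i)) ≤
      ∑ j ∈ U.erase i, logGeomFactorial (if R j (σ i) then outDeg R j - 1 else outDeg R j) := by
    intro σ hσ i hi
    rw [hQ]
    refine (ih _ (erase_ssubset hi) (forceEdge R i (σ i)) ?_).trans_eq ?_
    · intro a ha k hk
      rcases eq_or_ne a i with rfl | hai
      · obtain rfl : k = σ a := hk.2.1 rfl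
        exact ⟨fun k' hk' => hk'.2.1 rfl, fun j hj => hj.2.2 rfl⟩
      · have haU : a ∉ U := fun h => ha (mem_erase.2 ⟨hai, h⟩)
        obtain ⟨h1, h2⟩ := hR a haU k hk.1
        exact ⟨fun k' hk' => h1 k' hk'.1, fun j hj => h2 j hj.1⟩
    · refine sum_congr rfl fun j hj => ?_
      rw [outDeg_forceEdge_of_ne (mem_erase.1 hj).1]
  have hcol : ∀ σ ∈ permsIn R, ∀ j ∈ U, Real.log (outDeg R j) +
      ∑ i ∈ U.erase j, logGeomFactorial (if R j (σ i) then outDeg R j - 1 else outDeg R j) =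
      U.card * logGeomFactorial (outDeg R j) := by
    intro σ hσ j hj
    have hσ' := mem_permsIn.1 hσ
    have hcard : ((U.erase j).filter fun i => R j (σ i)).card = outDeg R j - 1 := by
      unfold outDeg
      rw [← card_erase_of_mem (a := σ j) (by simpa using hσ' j)]
      refine card_bij (fun i _ => σ i) ?_ (fun _ _ _ _ h => σ.injective h) ?_
      · intro i hi
        simp only [mem_filter, mem_erase] at hi
        simp [hi.1.1, hi.2]
      · intro k hk
        simp only [mem_filter, mem_erase, mem_univ, true_and] at hk
        refine ⟨σ.symm k, ?_, by simp⟩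
        have hne : σ.symm k ≠ j := fun h => hk.1 (by rw [← h]; simp)
        simp only [mem_filter, mem_erase, Equiv.apply_symm_apply]
        refine ⟨⟨hne, ?_⟩, hk.2⟩
        by_contra hnU
        have := (hR _ hnU k (by simpa using hσ' (σ.symm k))).2 j hk.2
        exact hne this.symm
    have hr1 : 1 ≤ outDeg R j := card_pos.2 ⟨σ j, by simpa using hσ' j⟩
    have hle : outDeg R j - 1 ≤ (U.erase j).card := hcard ▸ card_filter_le _ _
    have hneg : (((U.erase j).filter fun i => ¬ R j (σ i)).card : ℝ) =
        U.card - outDeg R j := by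
      have h1 := card_filter_add_card_filter_not (s := U.erase j) (fun i => R j (σ i))
      rw [hcard, card_erase_of_mem hj] at h1
      have h2 := card_pos.2 ⟨j, hj⟩
      have : ((U.erase j).filter fun i => ¬ R j (σ i)).card + outDeg R j = U.card := by omega
      rw [← this]
      push_cast
      ring
    have hsplit : ∀ i, logGeomFactorial (if R j (σ i) then outDeg R j - 1 else outDeg R j) =
        if R j (σ i) then logGeomFactorial (outDeg R j - 1) else logGeomFactorial (outDeg R j) :=
      fun i => apply_ite _ _ _ _
    simp only [hsplit]
    rw [sum_ite, sum_const, sum_const, nsmul_eq_mul, nsmul_eq_mul, hcard, hneg]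
    linarith [logGeomFactorial_step hr1]
  have htotal : U.card * (P * Real.log P) ≤
      P * (U.card * ∑ j ∈ U, logGeomFactorial (outDeg R j)) := by
    calc U.card * (P * Real.log P) = ∑ i ∈ U, P * Real.log P := by
          rw [sum_const, nsmul_eq_mul]
      _ ≤ ∑ i ∈ U, ∑ σ ∈ permsIn R, (Real.log (outDeg R i) + Real.log (Q i (σ i))) :=
          sum_le_sum fun i _ => hrow i
      _ = ∑ σ ∈ permsIn R, ∑ i ∈ U, (Real.log (outDeg R i) + Real.log (Q i (σ i))) := sum_comm
      _ ≤ ∑ σ ∈ permsIn R, ∑ j ∈ U, U.card * logGeomFactorial (outDeg R j) := by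
          refine sum_le_sum fun σ hσ => ?_
          rw [sum_add_distrib, ← sum_congr rfl (hcol σ hσ), sum_add_distrib]
          refine add_le_add le_rfl ((sum_le_sum (hstep σ hσ)).trans_eq ?_)
          exact sum_comm' (by simp only [mem_erase]; tauto)
      _ = _ := by rw [sum_const, nsmul_eq_mul, ← hP, ← mul_sum]
  have h3 : (P * U.card) * Real.log P ≤
      (P * U.card) * ∑ j ∈ U, logGeomFactorial (outDeg R j) := by linarith
  rw [← hP]
  exact le_of_mul_le_mul_left h3 (by positivity)

end Bregman

section RealRooted
open Polynomial

/-- The linear coefficient of a monic split polynomial in terms of its roots. -/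
theorem coeff_one_prod_X_sub_C {K : Type*} [Field K] (s : Multiset K) (hs : (0 : K) ∉ s) :
    (s.map fun r => X - C r).prod.coeff 1 =
      (s.map fun r => X - C r).prod.coeff 0 * (s.map fun r => -r⁻¹).sum := by
  induction s using Multiset.induction_on with
  | empty => simp [coeff_one]
  | cons a s ih =>
    simp only [Multiset.mem_cons, not_or] at hs
    simp only [Multiset.map_cons, Multiset.prod_cons, Multiset.sum_cons, sub_mul, coeff_sub,
      coeff_C_mul, coeff_X_mul, coeff_X_mul_zero, ih hs.2]
    have ha : a ≠ 0 := fun h => hs.1 h.symm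
    field_simp
    ring

theorem norm_prod_X_sub_C_le (s : Multiset ℂ) (hs : ∀ r ∈ s, r.re < 0 ∧ r.im = 0) {t : ℝ}
    (ht : 0 ≤ t) :
    ‖(s.map fun r => X - C r).prod.eval (t : ℂ)‖ ≤
      ‖(s.map fun r => X - C r).prod.coeff 0‖ *
        Real.exp (t * (s.map fun r => -r⁻¹).sum.re) := by
  induction s using Multiset.induction_on with
  | empty => simp
  | cons a s ih =>
    obtain ⟨h1, h2⟩ := hs a (Multiset.mem_cons_self a s)
    obtain ⟨b, hb, rfl⟩ : ∃ b : ℝ, 0 < b ∧ a = ((-b : ℝ) : ℂ) :=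
      ⟨-a.re, by linarith, by apply Complex.ext <;> simp [h2]⟩
    have ih := ih fun r hr => hs r (Multiset.mem_cons_of_mem hr)
    simp only [Multiset.map_cons, Multiset.prod_cons, Multiset.sum_cons, sub_mul, coeff_sub,
      coeff_C_mul, coeff_X_mul_zero, eval_sub, eval_mul, eval_X, eval_C, zero_sub, norm_neg,
      norm_mul, Complex.add_re, mul_add, Real.exp_add]
    have e1 : ‖(t : ℂ) * eval (t : ℂ) (s.map fun r => X - C r).prod -
        ((-b : ℝ) : ℂ) * eval (t : ℂ) (s.map fun r => X - C r).prod‖ =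
        (t + b) * ‖eval (t : ℂ) (s.map fun r => X - C r).prod‖ := by
      rw [← sub_mul, norm_mul, ← Complex.ofReal_sub, Complex.norm_real, Real.norm_eq_abs,
        abs_of_pos (by linarith)]
      ring
    have e2 : ‖((-b : ℝ) : ℂ)‖ = b := by
      rw [Complex.norm_real, Real.norm_eq_abs, abs_neg, abs_of_pos hb]
    have e3 : (-((-b : ℝ) : ℂ)⁻¹).re = b⁻¹ := by
      rw [← Complex.ofReal_inv, ← Complex.ofReal_neg, Complex.ofReal_re, inv_neg, neg_neg]
    rw [e1, e2, e3]
    have e4 : t + b ≤ b * Real.exp (t * b⁻¹) := by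
      have := Real.add_one_le_exp (t * b⁻¹)
      calc t + b = b * (t * b⁻¹ + 1) := by field_simp
        _ ≤ _ := mul_le_mul_of_nonneg_left this hb.le
    calc _ ≤ _ := mul_le_mul e4 ih (norm_nonneg _) (by positivity)
      _ = _ := by ring

theorem roots_ne_zero_of_coeff_zero_ne_zero {f : ℂ[X]} (h0 : f.coeff 0 ≠ 0) :
    (0 : ℂ) ∉ f.roots := fun h => h0 (by
  rw [coeff_zero_eq_eval_zero]
  exact (mem_roots'.1 h).2)

theorem eq_C_mul_prod_roots (f : ℂ[X]) :
    f = C f.leadingCoeff * (f.roots.map fun r => X - C r).prod :=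
  (IsAlgClosed.splits f).eq_prod_roots

theorem coeff_one_eq_coeff_zero_mul_sum {f : ℂ[X]} (h0 : f.coeff 0 ≠ 0) :
    f.coeff 1 = f.coeff 0 * (f.roots.map fun r => -r⁻¹).sum := by
  have h := coeff_one_prod_X_sub_C _ (roots_ne_zero_of_coeff_zero_ne_zero h0)
  conv_lhs => rw [eq_C_mul_prod_roots f]
  conv_rhs => rw [eq_C_mul_prod_roots f]
  rw [coeff_C_mul, coeff_C_mul, h, mul_assoc, ← eq_C_mul_prod_roots f]

/-- A nonconstant polynomial with all roots in the open left half plane has nonzero linear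
coefficient. -/
theorem coeff_one_ne_zero_of_roots_re_neg {f : ℂ[X]} (hf : 0 < f.natDegree)
    (hroots : ∀ r, f.eval r = 0 → r.re < 0) : f.coeff 1 ≠ 0 := by
  have h0 : f.coeff 0 ≠ 0 := fun h => by
    rw [coeff_zero_eq_eval_zero] at h
    simpa using hroots 0 h
  rw [coeff_one_eq_coeff_zero_mul_sum h0]
  refine mul_ne_zero h0 fun h => ?_
  have hne : f.roots ≠ 0 := by
    rw [← Multiset.card_pos, ← (IsAlgClosed.splits f).natDegree_eq_card_roots]
    exact hf
  have hpos : ∀ s : Multiset ℂ, s ≠ 0 → (∀ r ∈ s, r.re < 0) →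
      0 < (s.map fun r => -r⁻¹).sum.re := by
    intro s
    induction s using Multiset.induction_on with
    | empty => simp
    | cons a s ih =>
      intro _ hs
      have ha : 0 < (-a⁻¹).re := by
        have h1 := hs a (Multiset.mem_cons_self a s)
        have h2 : 0 < Complex.normSq a := Complex.normSq_pos.2 fun h => by simp [h] at h1
        rw [Complex.neg_re, Complex.inv_re, ← neg_div]
        exact div_pos (by linarith) h2
      rw [Multiset.map_cons, Multiset.sum_cons, Complex.add_re]
      rcases eq_or_ne s 0 with rfl | hs0
      · simpa using ha
      · exact add_pos ha (ih hs0 fun r hr => hs r (Multiset.mem_cons_of_mem hr))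
  have := hpos _ hne fun r hr => hroots r (mem_roots'.1 hr).2
  rw [h] at this
  simp at this

/-- Log-concavity on `[0, ∞)` of a polynomial with negative roots, compared to its tangent
at `0`. -/
theorem eval_le_of_complex_roots_neg {f : ℝ[X]} (h0 : 0 < f.coeff 0)
    (hroots : ∀ r : ℂ, aeval r f = 0 → r.re < 0 ∧ r.im = 0) {t : ℝ} (ht : 0 ≤ t) :
    f.eval t ≤ f.coeff 0 * Real.exp (t * (f.coeff 1 / f.coeff 0)) := by
  set F : ℂ[X] := f.map (algebraMap ℝ ℂ) with hF
  have hc : ∀ i, F.coeff i = f.coeff i := fun i => by simp [hF]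
  have hF0 : F.coeff 0 ≠ 0 := by
    rw [hc]
    exact_mod_cast h0.ne'
  have hsum : (F.roots.map fun r => -r⁻¹).sum.re = f.coeff 1 / f.coeff 0 := by
    have h := coeff_one_eq_coeff_zero_mul_sum hF0
    have h' : (F.roots.map fun r => -r⁻¹).sum = ((f.coeff 1 / f.coeff 0 : ℝ) : ℂ) := by
      rw [Complex.ofReal_div, ← hc 1, ← hc 0, h, mul_div_cancel_left₀ _ hF0]
    rw [h', Complex.ofReal_re]
  have hev : F.eval (t : ℂ) = (f.eval t : ℝ) := by
    rw [hF, eval_map_algebraMap]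
    exact aeval_algebraMap_apply_eq_algebraMap_eval t f
  have key := norm_prod_X_sub_C_le F.roots (fun r hr => hroots r (by
    have := (mem_roots'.1 hr).2
    rwa [IsRoot.def, hF, eval_map_algebraMap] at this)) ht
  rw [hsum] at key
  have h1 : ‖F.eval (t : ℂ)‖ =
      ‖F.leadingCoeff‖ * ‖(F.roots.map fun r => X - C r).prod.eval (t : ℂ)‖ := by
    conv_lhs => rw [eq_C_mul_prod_roots F]
    rw [eval_mul, eval_C, norm_mul]
  have h2 : ‖F.coeff 0‖ =
      ‖F.leadingCoeff‖ * ‖(F.roots.map fun r => X - C r).prod.coeff 0‖ := by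
    conv_lhs => rw [eq_C_mul_prod_roots F]
    rw [coeff_C_mul, norm_mul]
  rw [hc, Complex.norm_real, Real.norm_eq_abs, abs_of_pos h0] at h2
  rw [hev, Complex.norm_real] at h1
  calc f.eval t ≤ ‖f.eval t‖ := Real.le_norm_self _
    _ ≤ ‖F.leadingCoeff‖ * (_ * _) := by
        rw [h1]
        exact mul_le_mul_of_nonneg_left key (norm_nonneg _)
    _ = _ := by rw [← mul_assoc, ← h2]

end RealRooted

section Capacity
open MvPolynomial
open scoped Polynomial

/-- A real homogeneous polynomial of degree `d` with nonnegative coefficients that does not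
vanish on the closed right half-plane, except possibly where all coordinates are imaginary. -/
structure StrictlyStable {n : ℕ} (p : MvPolynomial (Fin n) ℝ) (d : ℕ) : Prop where
  isHomogeneous : p.IsHomogeneous d
  coeff_nonneg : ∀ m, 0 ≤ p.coeff m
  aeval_ne_zero : ∀ z : Fin n → ℂ, (∀ i, 0 ≤ (z i).re) → (∃ i, 0 < (z i).re) →
    aeval z p ≠ 0

/-- `p` as a univariate polynomial in its first variable, the others being specialised to `z`. -/
noncomputable def firstVar {n : ℕ} {A : Type*} [CommRing A] [Algebra ℝ A]
    (p : MvPolynomial (Fin (n + 1)) ℝ) (z : Fin n → A) : A[X] :=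
  (finSuccEquiv ℝ n p).map ((aeval z : MvPolynomial (Fin n) ℝ →ₐ[ℝ] A) : _ →+* A)

theorem eval_firstVar {n : ℕ} {A : Type*} [CommRing A] [Algebra ℝ A]
    (p : MvPolynomial (Fin (n + 1)) ℝ) (z : Fin n → A) (t : A) :
    (firstVar p z).eval t = aeval (Fin.cons t z : Fin (n + 1) → A) p := by
  unfold firstVar
  induction p using MvPolynomial.induction_on with
  | C a => simp [finSuccEquiv_apply]
  | add p q hp hq => simp only [map_add, Polynomial.map_add, Polynomial.eval_add, hp, hq]
  | mul_X p i hp =>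
    simp only [map_mul, Polynomial.map_mul, Polynomial.eval_mul, hp, aeval_X]
    congr 1
    refine Fin.cases ?_ (fun j => ?_) i
    · simp [finSuccEquiv_X_zero]
    · simp [finSuccEquiv_X_succ]

theorem coeff_firstVar {n : ℕ} {A : Type*} [CommRing A] [Algebra ℝ A]
    (p : MvPolynomial (Fin (n + 1)) ℝ) (z : Fin n → A) (i : ℕ) :
    (firstVar p z).coeff i = aeval z ((finSuccEquiv ℝ n p).coeff i) := by
  simp [firstVar]

theorem aeval_smul_of_isHomogeneous {n d : ℕ} {A : Type*} [CommRing A] [Algebra ℝ A]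
    {p : MvPolynomial (Fin n) ℝ} (hp : p.IsHomogeneous d) (c : A) (z : Fin n → A) :
    aeval (c • z) p = c ^ d * aeval z p := by
  have h : ∀ w : Fin n → A, aeval w p = MvPolynomial.eval₂ (algebraMap ℝ A) w p := fun w => rfl
  rw [h, h, MvPolynomial.eval₂_eq, MvPolynomial.eval₂_eq, Finset.mul_sum]
  refine Finset.sum_congr rfl fun m hm => ?_
  have hd : m.degree = d := by
    rw [Finsupp.degree_eq_weight_one]
    exact hp (mem_support_iff.1 hm)
  have : ∏ i ∈ m.support, c ^ m i = c ^ d := by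
    rw [Finset.prod_pow_eq_pow_sum, ← hd]
    rfl
  simp only [Pi.smul_apply, smul_eq_mul, mul_pow, Finset.prod_mul_distrib, this]
  ring

theorem natDegree_firstVar_le {n d : ℕ} {A : Type*} [CommRing A] [Algebra ℝ A]
    {p : MvPolynomial (Fin (n + 1)) ℝ} (hp : p.IsHomogeneous d) (z : Fin n → A) :
    (firstVar p z).natDegree ≤ d := by
  have h1 : (firstVar p z).natDegree ≤ (finSuccEquiv ℝ n p).natDegree :=
    Polynomial.natDegree_map_le
  rw [natDegree_finSuccEquiv] at h1
  exact h1.trans ((degreeOf_le_totalDegree p 0).trans hp.totalDegree_le)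

variable {n d : ℕ}

theorem StrictlyStable.re_neg_of_root {p : MvPolynomial (Fin (n + 1)) ℝ}
    (hp : StrictlyStable p d) {z : Fin n → ℂ} (hz : ∀ i, 0 ≤ (z i).re)
    (hz' : ∃ i, 0 < (z i).re) {r : ℂ} (hr : (firstVar p z).eval r = 0) : r.re < 0 := by
  by_contra! h
  rw [eval_firstVar] at hr
  refine hp.aeval_ne_zero _ (fun i => ?_) ?_ hr
  · refine Fin.cases ?_ (fun j => ?_) i
    · simpa using h
    · simpa using hz j
  · obtain ⟨i, hi⟩ := hz'
    exact ⟨i.succ, by simpa using hi⟩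

theorem StrictlyStable.im_eq_zero_of_root {p : MvPolynomial (Fin (n + 1)) ℝ}
    (hp : StrictlyStable p d) {x : Fin n → ℝ} (hx : ∀ i, 0 < x i) (i₀ : Fin n) {r : ℂ}
    (hr : (firstVar p fun i => (x i : ℂ)).eval r = 0) : r.im = 0 := by
  by_contra h
  rw [eval_firstVar] at hr
  obtain ⟨c, hc⟩ : ∃ c : ℂ, c = ⟨1, r.re / r.im⟩ := ⟨_, rfl⟩
  refine hp.aeval_ne_zero (c • (Fin.cons r fun i => (x i : ℂ))) (fun i => ?_)
    ⟨i₀.succ, ?_⟩ ?_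
  · refine Fin.cases ?_ (fun j => ?_) i
    · simp only [Pi.smul_apply, Fin.cons_zero, smul_eq_mul, Complex.mul_re, hc]
      field_simp
      simp
    · simp [hc, (hx j).le]
  · simp [hc, hx]
  · rw [aeval_smul_of_isHomogeneous hp.isHomogeneous, hr, mul_zero]

theorem aeval_nonneg {p : MvPolynomial (Fin n) ℝ} (hp : ∀ m, 0 ≤ p.coeff m) {x : Fin n → ℝ}
    (hx : ∀ i, 0 ≤ x i) : 0 ≤ aeval x p := by
  have : aeval x p = MvPolynomial.eval₂ (algebraMap ℝ ℝ) x p := rfl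
  rw [this, MvPolynomial.eval₂_eq]
  exact Finset.sum_nonneg fun m _ =>
    mul_nonneg (hp m) (Finset.prod_nonneg fun i _ => pow_nonneg (hx i) _)

theorem mvAeval_ofReal (p : MvPolynomial (Fin n) ℝ) (x : Fin n → ℝ) :
    aeval (fun i => (x i : ℂ)) p = ((aeval x p : ℝ) : ℂ) :=
  aeval_algebraMap_apply ℂ x p

theorem StrictlyStable.aeval_pos {p : MvPolynomial (Fin n) ℝ} (hp : StrictlyStable p d)
    {x : Fin n → ℝ} (hx : ∀ i, 0 ≤ x i) (hx' : ∃ i, 0 < x i) : 0 < aeval x p := by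
  refine lt_of_le_of_ne (aeval_nonneg hp.coeff_nonneg hx) fun h => ?_
  refine hp.aeval_ne_zero (fun i => (x i : ℂ)) (by simpa using hx) (by simpa using hx') ?_
  rw [mvAeval_ofReal, ← h, Complex.ofReal_zero]

theorem StrictlyStable.finSuccEquiv_coeff_one {p : MvPolynomial (Fin (n + 1)) ℝ}
    (hp : StrictlyStable p (d + 1)) : StrictlyStable ((finSuccEquiv ℝ n p).coeff 1) d where
  isHomogeneous := hp.isHomogeneous.finSuccEquiv_coeff_isHomogeneous 1 d (add_comm 1 d)
  coeff_nonneg m := by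
    rw [finSuccEquiv_coeff_coeff]
    exact hp.coeff_nonneg _
  aeval_ne_zero z hz hz' := by
    rw [← coeff_firstVar]
    refine coeff_one_ne_zero_of_roots_re_neg ?_ fun r hr => hp.re_neg_of_root hz hz' hr
    have hsmul : ∀ i j, i + j = d + 1 → ∀ w : Fin n → ℂ,
        aeval (0 : Fin n → ℂ) ((finSuccEquiv ℝ n p).coeff i) =
          0 ^ j * aeval w ((finSuccEquiv ℝ n p).coeff i) := fun i j hij w => by
      rw [← aeval_smul_of_isHomogeneous
        (hp.isHomogeneous.finSuccEquiv_coeff_isHomogeneous i j hij), zero_smul]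
    have hdeg := Nat.lt_succ_of_le (natDegree_firstVar_le hp.isHomogeneous (0 : Fin n → ℂ))
    have htop : (firstVar p z).coeff (d + 1) ≠ 0 := by
      have h1 : (firstVar p (0 : Fin n → ℂ)).eval 1 ≠ 0 := by
        rw [eval_firstVar]
        refine hp.aeval_ne_zero _ (fun i => ?_) ⟨0, by simp⟩
        refine Fin.cases ?_ (fun j => ?_) i <;> simp
      rw [Polynomial.eval_eq_sum_range' hdeg, Finset.sum_eq_single (d + 1)] at h1
      · rw [coeff_firstVar, hsmul (d + 1) 0 rfl z] at h1
        rw [coeff_firstVar]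
        simpa using h1
      · intro i hi hne
        rw [Finset.mem_range] at hi
        rw [coeff_firstVar, hsmul i (d + 1 - i) (by omega) z, zero_pow (by omega)]
        simp
      · simp
    have := Polynomial.le_natDegree_of_ne_zero htop
    omega

theorem StrictlyStable.mul_le_aeval_coeff_one {p : MvPolynomial (Fin (n + 1)) ℝ}
    (hp : StrictlyStable p (n + 1)) {c : ℝ}
    (hcap : ∀ x : Fin (n + 1) → ℝ, (∀ i, 0 < x i) → c * ∏ i, x i ≤ aeval x p)
    {x : Fin n → ℝ} (hx : ∀ i, 0 < x i) :
    c * Real.exp (-1) * ∏ i, x i ≤ aeval x ((finSuccEquiv ℝ n p).coeff 1) := by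
  have hcap' : ∀ t, 0 < t → c * (t * ∏ i, x i) ≤ (firstVar p x).eval t := fun t ht => by
    rw [eval_firstVar]
    refine le_of_eq_of_le ?_ (hcap _ fun i => ?_)
    · rw [Fin.prod_univ_succ]
      simp
    · refine Fin.cases ?_ (fun j => ?_) i
      · simpa using ht
      · simpa using hx j
  have hq := hp.finSuccEquiv_coeff_one
  rw [← coeff_firstVar]
  rcases Nat.eq_zero_or_pos n with rfl | hn
  · have h1 := hcap' 1 one_pos
    have h2 := Nat.lt_succ_of_le (natDegree_firstVar_le hp.isHomogeneous x)
    have h3 := aeval_smul_of_isHomogeneous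
      (hp.isHomogeneous.finSuccEquiv_coeff_isHomogeneous 0 1 rfl) 0 x
    rw [Subsingleton.elim ((0 : ℝ) • x) x, pow_one, zero_mul, ← coeff_firstVar] at h3
    have h4 := aeval_nonneg hq.coeff_nonneg fun i => (hx i).le
    rw [← coeff_firstVar] at h4
    have h5 : Real.exp (-1) ≤ 1 := Real.exp_le_one_iff.2 (by norm_num)
    rw [Polynomial.eval_eq_sum_range' h2] at h1
    simp only [Finset.univ_eq_empty, Finset.prod_empty, Finset.sum_range_succ, h3] at h1 ⊢
    simp only [Finset.sum_range_zero, one_pow, mul_one, zero_add] at h1 ⊢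
    rcases le_total 0 c with hc | hc
    · exact (mul_le_of_le_one_right hc h5).trans h1
    · exact (mul_nonpos_of_nonpos_of_nonneg hc (Real.exp_pos _).le).trans h4
  obtain ⟨i₀⟩ : Nonempty (Fin n) := ⟨⟨0, hn⟩⟩
  have h1 : 0 < (firstVar p x).coeff 1 := by
    rw [coeff_firstVar]
    exact hq.aeval_pos (fun i => (hx i).le) ⟨i₀, hx _⟩
  have h0 : 0 < (firstVar p x).coeff 0 := by
    rw [Polynomial.coeff_zero_eq_eval_zero, eval_firstVar]
    refine hp.aeval_pos (fun i => ?_) ⟨i₀.succ, by simpa using hx _⟩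
    refine Fin.cases ?_ (fun j => ?_) i
    · simp
    · simpa using (hx j).le
  have hmap : ∀ r : ℂ, Polynomial.aeval r (firstVar p x) =
      (firstVar p fun i => (x i : ℂ)).eval r := fun r => by
    rw [← Polynomial.eval_map_algebraMap]
    congr 1
    ext i
    rw [Polynomial.coeff_map, coeff_firstVar, coeff_firstVar, mvAeval_ofReal]
    rfl
  set R := firstVar p x
  obtain ⟨t, ht⟩ : ∃ t, t = R.coeff 0 / R.coeff 1 := ⟨_, rfl⟩
  have htpos : 0 < t := ht ▸ div_pos h0 h1
  have h2 := (hcap' t htpos).trans (eval_le_of_complex_roots_neg h0 (fun r hr => by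
    rw [hmap] at hr
    exact ⟨hp.re_neg_of_root (fun i => (hx i).le) ⟨i₀, hx _⟩ hr,
      hp.im_eq_zero_of_root hx i₀ hr⟩) htpos.le)
  have h3 : t * (R.coeff 1 / R.coeff 0) = 1 := by
    rw [ht]
    field_simp
  have h4 : R.coeff 0 = t * R.coeff 1 := by
    rw [ht]
    field_simp
  rw [h3, h4] at h2
  have h5 : c * ∏ i, x i ≤ R.coeff 1 * Real.exp 1 := by
    refine le_of_mul_le_mul_left ?_ htpos
    linarith
  calc c * Real.exp (-1) * ∏ i, x i = (c * ∏ i, x i) * Real.exp (-1) := by ring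
    _ ≤ R.coeff 1 * Real.exp 1 * Real.exp (-1) :=
        mul_le_mul_of_nonneg_right h5 (Real.exp_pos _).le
    _ = R.coeff 1 := by rw [mul_assoc, ← Real.exp_add]; simp

/-- **Gurvits' capacity inequality**, with the constant `e⁻ⁿ`. -/
theorem StrictlyStable.mul_exp_neg_le_coeff (n : ℕ) : ∀ (p : MvPolynomial (Fin n) ℝ) (c : ℝ),
    StrictlyStable p n →
    (∀ x : Fin n → ℝ, (∀ i, 0 < x i) → c * ∏ i, x i ≤ aeval x p) →
    c * Real.exp (-n) ≤ p.coeff (Finsupp.equivFunOnFinite.symm 1) := by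
  induction n with
  | zero =>
    intro p c _ hcap
    have h := hcap 0 (fun i => i.elim0)
    rw [eq_C_of_isEmpty p] at h ⊢
    simpa [Subsingleton.elim (Finsupp.equivFunOnFinite.symm 1) (0 : Fin 0 →₀ ℕ)] using h
  | succ n ih =>
    intro p c hp hcap
    have := ih _ _ hp.finSuccEquiv_coeff_one fun x hx => hp.mul_le_aeval_coeff_one hcap hx
    rw [finSuccEquiv_coeff_coeff] at this
    have hm : (Finsupp.equivFunOnFinite.symm (1 : Fin n → ℕ)).cons 1 =
        Finsupp.equivFunOnFinite.symm (1 : Fin (n + 1) → ℕ) := by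
      ext i
      refine Fin.cases ?_ (fun j => ?_) i <;> simp
    rw [hm, mul_assoc, ← Real.exp_add] at this
    convert this using 3
    push_cast
    ring

end Capacity

section VanDerWaerden
open MvPolynomial Finset

/-- The product of the row forms of a matrix. -/
noncomputable def rowProduct {n : ℕ} (a : Fin n → Fin n → ℝ) : MvPolynomial (Fin n) ℝ :=
  ∏ i, ∑ j, C (a i j) * X j

variable {n : ℕ} {a : Fin n → Fin n → ℝ}

theorem coeff_rowProduct (a : Fin n → Fin n → ℝ) (m : Fin n →₀ ℕ) :
    (rowProduct a).coeff m =
      ∑ g : Fin n → Fin n, if ∑ i, Finsupp.single (g i) 1 = m then ∏ i, a i (g i) else 0 := by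
  unfold rowProduct
  rw [prod_univ_sum, Fintype.piFinset_univ, coeff_sum]
  refine sum_congr rfl fun g _ => ?_
  have h : ∏ i, C (a i (g i)) * (X (g i) : MvPolynomial (Fin n) ℝ) =
      monomial (∑ i, Finsupp.single (g i) 1) (∏ i, a i (g i)) := by
    rw [monomial_sum_index]
    simp [prod_mul_distrib, X]
  rw [h, coeff_monomial]

theorem coeff_one_rowProduct (a : Fin n → Fin n → ℝ) :
    (rowProduct a).coeff (Finsupp.equivFunOnFinite.symm 1) =
      ∑ σ : Equiv.Perm (Fin n), ∏ i, a i (σ i) := by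
  rw [coeff_rowProduct, ← sum_filter]
  symm
  refine sum_bij (fun σ _ => ⇑σ) ?_ (fun _ _ _ _ h => Equiv.ext (congrFun h)) ?_ (fun _ _ => rfl)
  · intro σ _
    rw [mem_filter]
    refine ⟨mem_univ _, ?_⟩
    ext j
    rw [Finsupp.finsetSum_apply, Equiv.sum_comp σ (fun k => Finsupp.single k 1 j)]
    simp [Finsupp.single_apply]
  · intro g hg
    rw [mem_filter] at hg
    have hsurj : Function.Surjective g := by
      intro j
      by_contra! h
      have := DFunLike.congr_fun hg.2 j
      rw [Finsupp.finsetSum_apply, sum_eq_zero (fun i _ => by simp [h i])] at this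
      simp at this
    exact ⟨Equiv.ofBijective g (Finite.surjective_iff_bijective.1 hsurj), mem_univ _, rfl⟩

theorem aeval_rowProduct {A : Type*} [CommRing A] [Algebra ℝ A] (a : Fin n → Fin n → ℝ)
    (z : Fin n → A) : aeval z (rowProduct a) = ∏ i, ∑ j, algebraMap ℝ A (a i j) * z j := by
  simp [rowProduct]

theorem strictlyStable_rowProduct (ha : ∀ i j, 0 < a i j) : StrictlyStable (rowProduct a) n where
  isHomogeneous := by
    have h := IsHomogeneous.prod (univ : Finset (Fin n))
      (fun i => ∑ j, C (a i j) * (X j : MvPolynomial (Fin n) ℝ)) (fun _ => 1) fun i _ =>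
        IsHomogeneous.sum _ _ _ fun j _ => by
          simpa using (isHomogeneous_C (Fin n) (a i j)).mul (isHomogeneous_X ℝ j)
    simpa [rowProduct] using h
  coeff_nonneg m := by
    rw [coeff_rowProduct]
    refine sum_nonneg fun g _ => ?_
    split_ifs
    · exact prod_nonneg fun i _ => (ha _ _).le
    · exact le_rfl
  aeval_ne_zero z hz hz' := by
    rw [aeval_rowProduct, prod_ne_zero_iff]
    intro i _ h
    obtain ⟨j, hj⟩ := hz'
    have : 0 < (∑ j, algebraMap ℝ ℂ (a i j) * z j).re := by
      rw [Complex.re_sum]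
      refine sum_pos' (fun k _ => ?_) ⟨j, mem_univ _, ?_⟩
      · simpa using mul_nonneg (ha i k).le (hz k)
      · simpa using mul_pos (ha i j) hj
    rw [h] at this
    simp at this

theorem prod_le_aeval_rowProduct (ha : ∀ i j, 0 ≤ a i j) (hrow : ∀ i, ∑ j, a i j = 1)
    (hcol : ∀ j, ∑ i, a i j = 1) {x : Fin n → ℝ} (hx : ∀ i, 0 < x i) :
    ∏ i, x i ≤ aeval x (rowProduct a) := by
  rw [aeval_rowProduct]
  calc ∏ j, x j = ∏ i, ∏ j, x j ^ a i j := by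
        rw [prod_comm]
        refine prod_congr rfl fun j _ => ?_
        rw [← Real.rpow_sum_of_pos (hx j), hcol, Real.rpow_one]
    _ ≤ _ := prod_le_prod (fun i _ => prod_nonneg fun j _ => (Real.rpow_pos_of_pos (hx j) _).le)
        fun i _ => Real.geom_mean_le_arith_mean_weighted univ (a i) x (fun j _ => ha i j)
          (hrow i) fun j _ => (hx j).le

theorem exp_neg_le_sum_perm_of_pos (ha : ∀ i j, 0 < a i j) (hrow : ∀ i, ∑ j, a i j = 1)
    (hcol : ∀ j, ∑ i, a i j = 1) :
    Real.exp (-n) ≤ ∑ σ : Equiv.Perm (Fin n), ∏ i, a i (σ i) := by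
  have := StrictlyStable.mul_exp_neg_le_coeff n (rowProduct a) 1 (strictlyStable_rowProduct ha)
    fun x hx => by
      rw [one_mul]
      exact prod_le_aeval_rowProduct (fun i j => (ha i j).le) hrow hcol hx
  rwa [one_mul, coeff_one_rowProduct] at this

/-- A weak form of **van der Waerden's conjecture**: the permanent of a doubly stochastic matrix
is at least `e⁻ⁿ`. -/
theorem exp_neg_le_sum_perm (ha : ∀ i j, 0 ≤ a i j) (hrow : ∀ i, ∑ j, a i j = 1)
    (hcol : ∀ j, ∑ i, a i j = 1) :
    Real.exp (-n) ≤ ∑ σ : Equiv.Perm (Fin n), ∏ i, a i (σ i) := by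
  rcases Nat.eq_zero_or_pos n with rfl | hn
  · simp
  have hn' : (0 : ℝ) < n := by exact_mod_cast hn
  let f : ℝ → ℝ := fun ε => ∑ σ : Equiv.Perm (Fin n), ∏ i, ((1 - ε) * a i (σ i) + ε / n)
  have hf : Continuous f := by fun_prop
  have hlim : Filter.Tendsto f (nhdsWithin 0 (Set.Ioi 0)) (nhds (f 0)) :=
    hf.continuousAt.tendsto.mono_left nhdsWithin_le_nhds
  have hev : ∀ᶠ ε in nhdsWithin (0 : ℝ) (Set.Ioi 0), Real.exp (-n) ≤ f ε := by
    filter_upwards [Ioo_mem_nhdsGT (zero_lt_one' ℝ)] with ε hε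
    have h1 : 0 ≤ 1 - ε := by linarith [hε.2]
    refine exp_neg_le_sum_perm_of_pos (a := fun i j => (1 - ε) * a i j + ε / n)
      (fun i j => ?_) (fun i => ?_) (fun j => ?_)
    · exact add_pos_of_nonneg_of_pos (mul_nonneg h1 (ha i j)) (div_pos hε.1 hn')
    · rw [sum_add_distrib, ← mul_sum, hrow]
      simp
      field_simp
      ring
    · rw [sum_add_distrib, ← mul_sum, hcol]
      simp
      field_simp
      ring
  have := ge_of_tendsto hlim hev
  simpa [f] using this

theorem pow_div_exp_le_card_permsIn {V : Type*} [Fintype V] [DecidableEq V] {R : V → V → Prop}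
    {ρ : ℕ} (hρ : 0 < ρ) (hR : ∀ v, outDeg R v = ρ ∧ inDeg R v = ρ) :
    ((ρ : ℝ) / Real.exp 1) ^ Fintype.card V ≤ (permsIn R).card := by
  have hρ' : (0 : ℝ) < ρ := by exact_mod_cast hρ
  let e := (Fintype.equivFin V).symm
  let a : Fin (Fintype.card V) → Fin (Fintype.card V) → ℝ :=
    fun i j => if R (e i) (e j) then (ρ : ℝ)⁻¹ else 0
  have h := exp_neg_le_sum_perm (a := a) (fun i j => by
      simp only [a]
      split_ifs <;> positivity)
    (fun i => by
      rw [Equiv.sum_comp e fun v => if R (e i) v then (ρ : ℝ)⁻¹ else 0, ← sum_filter, sum_const,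
        nsmul_eq_mul]
      have : #(univ.filter fun v => R (e i) v) = ρ := (hR (e i)).1
      rw [this, mul_inv_cancel₀ hρ'.ne'])
    (fun j => by
      rw [Equiv.sum_comp e fun v => if R v (e j) then (ρ : ℝ)⁻¹ else 0, ← sum_filter, sum_const,
        nsmul_eq_mul]
      have : #(univ.filter fun v => R v (e j)) = ρ := (hR (e j)).2
      rw [this, mul_inv_cancel₀ hρ'.ne'])
  have hsum : ∑ σ : Equiv.Perm (Fin (Fintype.card V)), ∏ i, a i (σ i) =
      (permsIn R).card * ((ρ : ℝ)⁻¹) ^ Fintype.card V := by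
    have h1 : ∀ τ : Equiv.Perm V, (∏ v, if R v (τ v) then (ρ : ℝ)⁻¹ else 0) =
        if τ ∈ permsIn R then ((ρ : ℝ)⁻¹) ^ Fintype.card V else 0 := by
      intro τ
      split_ifs with hτ
      · rw [mem_permsIn] at hτ
        simp [hτ]
      · rw [mem_permsIn] at hτ
        push Not at hτ
        obtain ⟨v, hv⟩ := hτ
        exact prod_eq_zero (mem_univ v) (by simp [hv])
    calc _ = ∑ τ : Equiv.Perm V, ∏ v, if R v (τ v) then (ρ : ℝ)⁻¹ else 0 := by
          refine Fintype.sum_equiv e.permCongr _ _ fun σ => ?_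
          refine Fintype.prod_equiv e _ _ fun i => ?_
          simp [a, Equiv.permCongr_apply]
      _ = _ := by
          simp only [h1]
          rw [← sum_filter, sum_const, nsmul_eq_mul, filter_mem_eq_inter, univ_inter]
  rw [hsum, inv_pow, ← div_eq_mul_inv, le_div_iff₀ (by positivity)] at h
  rw [div_pow, ← Real.exp_nat_mul, mul_one, div_eq_mul_inv, ← Real.exp_neg, mul_comm]
  exact h

end VanDerWaerden

section Counting
open Finset
variable {V : Type*} [Fintype V] [DecidableEq V]

theorem exists_cycle_transversal (σ : Equiv.Perm V) :
    ∃ T : Finset V, T.card = σ.cycleType.card ∧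
      ∀ x ∈ T, ∀ y ∈ T, σ.SameCycle x y → x = y := by
  rcases isEmpty_or_nonempty V with hV | hV
  · exact ⟨∅, by simp [Subsingleton.elim σ 1], by simp⟩
  have hne : ∀ c ∈ σ.cycleFactorsFinset, ∃ x, x ∈ c.support := fun c hc => by
    obtain ⟨x, hx, -⟩ := (Equiv.Perm.mem_cycleFactorsFinset_iff.1 hc).1
    exact ⟨x, Equiv.Perm.mem_support.2 hx⟩
  choose! f hf using hne
  have hcyc : ∀ c ∈ σ.cycleFactorsFinset, c = σ.cycleOf (f c) := fun c hc =>
    Equiv.Perm.cycle_is_cycleOf (hf c hc) hc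
  refine ⟨σ.cycleFactorsFinset.image f, ?_, ?_⟩
  · rw [card_image_of_injOn, Equiv.Perm.cycleType_def, Multiset.card_map]
    · rfl
    · intro c hc c' hc' h
      rw [hcyc c hc, hcyc c' hc', h]
  · intro x hx y hy h
    obtain ⟨c, hc, rfl⟩ := mem_image.1 hx
    obtain ⟨c', hc', rfl⟩ := mem_image.1 hy
    have := h.cycleOf_eq
    rw [← hcyc c hc, ← hcyc c' hc'] at this
    rw [this]

/-- A permutation is determined off a transversal of its cycles. -/
theorem eq_of_agree_off_transversal {σ τ : Equiv.Perm V} {T : Finset V}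
    (hσ : ∀ x ∈ T, ∀ y ∈ T, σ.SameCycle x y → x = y)
    (hτ : ∀ x ∈ T, ∀ y ∈ T, τ.SameCycle x y → x = y)
    (hagree : ∀ v ∉ T, σ v = τ v) : σ = τ := by
  ext t
  by_cases ht : t ∈ T
  swap
  · exact hagree t ht
  have hex : ∃ m : ℕ, (τ ^ m) (τ t) = t := by
    obtain ⟨m, -, -, hm⟩ := (show τ.SameCycle (τ t) t from
      Equiv.Perm.SameCycle.symm ⟨1, by simp⟩).exists_pow_eq τ
    exact ⟨m, hm⟩
  have hoff : ∀ i < Nat.find hex, (τ ^ i) (τ t) ∉ T := fun i hi hmem => by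
    refine Nat.find_min hex hi (hτ _ hmem t ht ?_)
    refine Equiv.Perm.SameCycle.symm ⟨(i + 1 : ℕ), ?_⟩
    rw [zpow_natCast, pow_succ, Equiv.Perm.mul_apply]
  have hpow : ∀ i ≤ Nat.find hex, (σ ^ i) (τ t) = (τ ^ i) (τ t) := by
    intro i
    induction i with
    | zero => simp
    | succ i ih =>
      intro hi
      rw [pow_succ', pow_succ', Equiv.Perm.mul_apply, Equiv.Perm.mul_apply, ih (by omega)]
      exact hagree _ (hoff i (by omega))
  have hsame : σ.SameCycle (τ t) t :=
    ⟨(Nat.find hex : ℕ), by rw [zpow_natCast, hpow _ le_rfl, Nat.find_spec hex]⟩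
  obtain ⟨u, hu⟩ := σ.surjective (τ t)
  have hut : σ.SameCycle u t := by
    refine Equiv.Perm.SameCycle.trans ⟨1, ?_⟩ hsame
    simpa using hu
  by_cases huT : u ∈ T
  · rw [← hσ u huT t ht hut, hu, hσ u huT t ht hut]
  · have : u = t := τ.injective (by rw [← hagree u huT, hu])
    exact absurd (this ▸ ht) huT

theorem card_filter_transversal_le {R : V → V → Prop} {ρ : ℕ} (hR : ∀ v, outDeg R v = ρ)
    (T : Finset V) :
    ((permsIn R).filter fun σ => ∀ x ∈ T, ∀ y ∈ T, σ.SameCycle x y → x = y).card ≤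
      ρ ^ (Fintype.card V - T.card) := by
  calc _ ≤ (Fintype.piFinset fun v => if v ∈ T then {v} else univ.filter (R v)).card := by
        refine card_le_card_of_injOn (fun σ v => if v ∈ T then v else σ v) ?_ ?_
        · intro σ hσ
          have hσ' := mem_permsIn.1 (mem_filter.1 hσ).1
          rw [mem_coe, Fintype.mem_piFinset]
          intro v
          split_ifs with hv
          · simp [hv]
          · simpa [hv] using hσ' v
        · intro σ hσ τ hτ h
          refine eq_of_agree_off_transversal (mem_filter.1 hσ).2 (mem_filter.1 hτ).2 ?_
          intro v hv
          simpa [hv] using congrFun h v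
    _ = ∏ v, if v ∈ T then 1 else ρ := by
        rw [Fintype.card_piFinset]
        refine prod_congr rfl fun v _ => ?_
        split_ifs
        · simp
        · exact hR v
    _ = ρ ^ (Fintype.card V - T.card) := by
        rw [prod_ite, prod_const_one, one_mul, prod_const, ← card_compl]
        congr 2
        ext v
        simp

/-- Few permutations in a digraph have many cycles. -/
theorem card_filter_cycleType_le {R : V → V → Prop} {ρ : ℕ} (hρ : 0 < ρ)
    (hR : ∀ v, outDeg R v = ρ) (K : ℝ) :
    (((permsIn R).filter fun σ => K < σ.cycleType.card).card : ℝ) ≤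
      2 ^ Fintype.card V * ((ρ : ℝ) ^ Fintype.card V / (ρ : ℝ) ^ K) := by
  have hρ' : (0 : ℝ) < ρ := by exact_mod_cast hρ
  let S : Finset V → Finset (Equiv.Perm V) := fun T =>
    (permsIn R).filter fun σ => ∀ x ∈ T, ∀ y ∈ T, σ.SameCycle x y → x = y
  have hsub : ((permsIn R).filter fun σ => K < σ.cycleType.card) ⊆
      (univ.filter fun T : Finset V => K < T.card).biUnion S := by
    intro σ hσ
    rw [mem_filter] at hσ
    obtain ⟨T, hT, hT'⟩ := exists_cycle_transversal σ
    rw [mem_biUnion]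
    exact ⟨T, by simpa [hT] using hσ.2, mem_filter.2 ⟨hσ.1, hT'⟩⟩
  have hS : ∀ T ∈ univ.filter (fun T : Finset V => K < T.card),
      ((S T).card : ℝ) ≤ (ρ : ℝ) ^ Fintype.card V / (ρ : ℝ) ^ K := by
    intro T hT
    rw [mem_filter] at hT
    have h1 : ((S T).card : ℝ) ≤ (ρ : ℝ) ^ (Fintype.card V - T.card) := by
      exact_mod_cast card_filter_transversal_le hR T
    refine h1.trans ?_
    rw [pow_sub₀ _ hρ'.ne' (card_le_univ T), ← div_eq_mul_inv]
    refine div_le_div_of_nonneg_left (by positivity) (by positivity) ?_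
    rw [← Real.rpow_natCast]
    exact Real.rpow_le_rpow_of_exponent_le (by exact_mod_cast hρ) hT.2.le
  calc _ ≤ (((univ.filter fun T : Finset V => K < T.card).biUnion S).card : ℝ) := by
        exact_mod_cast card_le_card hsub
    _ ≤ ∑ T with K < (#T : ℝ), ((S T).card : ℝ) := by exact_mod_cast card_biUnion_le
    _ ≤ ∑ T with K < (#T : ℝ), (ρ : ℝ) ^ Fintype.card V / (ρ : ℝ) ^ K := sum_le_sum hS
    _ ≤ ∑ T : Finset V, (ρ : ℝ) ^ Fintype.card V / (ρ : ℝ) ^ K :=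
        sum_le_sum_of_subset_of_nonneg (filter_subset _ _) fun _ _ _ => by positivity
    _ = _ := by
        rw [sum_const, nsmul_eq_mul, card_univ, Fintype.card_finset]
        push_cast
        rfl

/-- The subgraph of `R` in which the vertices that are a source in `T` keep only their
edges in `T`. -/
def forceEdges (R : V → V → Prop) (T : Finset (V × V)) : V → V → Prop :=
  fun u v => R u v ∧ ∀ w, (u, w) ∈ T → v = w

theorem card_permsIn_forceEdges_le {R : V → V → Prop} {ρ : ℕ} (hR : ∀ v, outDeg R v ≤ ρ)
    (T : Finset (V × V)) :
    ((permsIn (forceEdges R T)).card : ℝ) ≤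
      Real.exp ((Fintype.card V - T.card) * logGeomFactorial ρ) := by
  rcases (permsIn (forceEdges R T)).eq_empty_or_nonempty with he | hne
  · rw [he]
    simpa using (Real.exp_pos _).le
  have hsrc : (T.image Prod.fst).card = T.card := by
    obtain ⟨σ, hσ⟩ := hne
    rw [mem_permsIn] at hσ
    refine card_image_of_injOn fun e he e' he' h => ?_
    have h1 := (hσ e.1).2 e.2 he
    have h2 := (hσ e'.1).2 e'.2 he'
    exact Prod.ext h (by rw [← h1, ← h2, h])
  rw [← Real.log_le_iff_le_exp (by exact_mod_cast hne.card_pos)]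
  refine (log_card_permsIn_le_sum univ _ (by simp)).trans ?_
  calc _ ≤ ∑ v, if v ∈ T.image Prod.fst then 0 else logGeomFactorial ρ := by
        refine sum_le_sum fun v _ => ?_
        split_ifs with hv
        · obtain ⟨⟨v, w⟩, he, rfl⟩ := mem_image.1 hv
          rw [← logGeomFactorial_one]
          refine logGeomFactorial_mono (card_le_one.2 fun x hx y hy => ?_)
          rw [mem_filter] at hx hy
          rw [hx.2.2 w he, hy.2.2 w he]
        · refine logGeomFactorial_mono (le_trans (card_le_card ?_) (hR v))
          exact monotone_filter_right _ fun u _ hu => hu.1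
    _ = _ := by
        rw [sum_ite, sum_const_zero, zero_add, sum_const, nsmul_eq_mul]
        congr 1
        rw [← hsrc, ← Nat.cast_sub (card_le_univ _), ← card_compl]
        congr 2
        ext v
        simp

/-- Few permutations in a digraph contain many edges of a sparse edge set. -/
theorem card_filter_many_edges_le {R E : V → V → Prop} {ρ : ℕ} (hR : ∀ v, outDeg R v ≤ ρ)
    (b : ℕ) :
    (((permsIn R).filter fun σ => b ≤ (univ.filter fun v => E v (σ v)).card).card : ℝ) ≤
      (univ.filter fun e : V × V => E e.1 e.2).card.choose b *
        Real.exp ((Fintype.card V - b) * logGeomFactorial ρ) := by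
  obtain ⟨𝓔, h𝓔⟩ : ∃ 𝓔, 𝓔 = univ.filter fun e : V × V => E e.1 e.2 := ⟨_, rfl⟩
  rw [← h𝓔]
  have hsub : ((permsIn R).filter fun σ => b ≤ (univ.filter fun v => E v (σ v)).card) ⊆
      (powersetCard b 𝓔).biUnion fun T => permsIn (forceEdges R T) := by
    intro σ hσ
    rw [mem_filter, mem_permsIn] at hσ
    obtain ⟨D, hD, hDb⟩ := exists_subset_card_eq hσ.2
    rw [mem_biUnion]
    refine ⟨D.image fun v => (v, σ v), ?_, ?_⟩
    · rw [mem_powersetCard, card_image_of_injective _ fun x y h => congrArg Prod.fst h]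
      refine ⟨?_, hDb⟩
      intro e he
      obtain ⟨v, hv, rfl⟩ := mem_image.1 he
      have := (mem_filter.1 (hD hv)).2
      simpa [h𝓔] using this
    · rw [mem_permsIn]
      refine fun v => ⟨hσ.1 v, fun w hw => ?_⟩
      obtain ⟨u, -, hu⟩ := mem_image.1 hw
      simp only [Prod.mk.injEq] at hu
      rw [← hu.1, hu.2]
  calc _ ≤ (((powersetCard b 𝓔).biUnion fun T => permsIn (forceEdges R T)).card : ℝ) := by
        exact_mod_cast card_le_card hsub
    _ ≤ ∑ T ∈ powersetCard b 𝓔, ((permsIn (forceEdges R T)).card : ℝ) := by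
        exact_mod_cast card_biUnion_le
    _ ≤ ∑ T ∈ powersetCard b 𝓔, Real.exp ((Fintype.card V - b) * logGeomFactorial ρ) := by
        refine sum_le_sum fun T hT => ?_
        rw [← (mem_powersetCard.1 hT).2]
        exact card_permsIn_forceEdges_le hR T
    _ = _ := by rw [sum_const, nsmul_eq_mul, card_powersetCard]

/-- The number of edges incident to a set of vertices of small degree. -/
theorem card_edges_incident_le {H : V → V → Prop} {A : Finset V} {D : ℝ}
    (hH : ∀ x ∈ A, (outDeg H x : ℝ) ≤ D ∧ (inDeg H x : ℝ) ≤ D) :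
    ((univ.filter fun e : V × V => H e.1 e.2 ∧ (e.1 ∈ A ∨ e.2 ∈ A)).card : ℝ) ≤
      2 * A.card * D := by
  have hsub : (univ.filter fun e : V × V => H e.1 e.2 ∧ (e.1 ∈ A ∨ e.2 ∈ A)) ⊆
      (A.biUnion fun x => (univ.filter fun u => H x u).image fun u => (x, u)) ∪
      (A.biUnion fun x => (univ.filter fun u => H u x).image fun u => (u, x)) := by
    rintro ⟨u, v⟩ h
    simp only [mem_filter, mem_univ, true_and] at h
    simp only [mem_union, mem_biUnion, mem_image, mem_filter, mem_univ, true_and,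
      Prod.mk.injEq]
    rcases h with ⟨h, hu | hv⟩
    · exact Or.inl ⟨u, hu, v, h, rfl, rfl⟩
    · exact Or.inr ⟨v, hv, u, h, rfl, rfl⟩
  have h1 := (card_le_card hsub).trans (card_union_le _ _)
  have himage : ∀ (P : V → Finset V) (g : V → V → V × V), (∀ x ∈ A, ((P x).card : ℝ) ≤ D) →
      ((A.biUnion fun x => (P x).image (g x)).card : ℝ) ≤ A.card * D := by
    intro P g hP
    calc ((A.biUnion fun x => (P x).image (g x)).card : ℝ)
        ≤ ∑ x ∈ A, (((P x).image (g x)).card : ℝ) := by exact_mod_cast card_biUnion_le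
      _ ≤ ∑ x ∈ A, D := sum_le_sum fun x hx =>
          le_trans (by exact_mod_cast card_image_le) (hP x hx)
      _ = A.card * D := by rw [sum_const, nsmul_eq_mul]
  have h2 := himage (fun x => univ.filter fun u => H x u) (fun x u => (x, u))
    fun x hx => (hH x hx).1
  have h3 := himage (fun x => univ.filter fun u => H u x) (fun x u => (u, x))
    fun x hx => (hH x hx).2
  have h4 := (Nat.cast_le (α := ℝ)).2 h1
  push_cast at h4
  linarith

end Counting

section Asymptotics
open Filter

theorem logGeomFactorial_le {r : ℕ} (hr : 0 < r) :
    logGeomFactorial r ≤ Real.log r - 1 + (1 + Real.log r) / r := by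
  have key : Real.log r.factorial ≤ 1 + Real.log r + r * Real.log r - r := by
    induction r, hr using Nat.le_induction with
    | base => simp
    | succ r hr ih =>
      have hr' : (0 : ℝ) < r := by exact_mod_cast hr
      have h1 : Real.log (r + 1).factorial = Real.log (r + 1) + Real.log r.factorial := by
        rw [Nat.factorial_succ]
        push_cast
        rw [Real.log_mul (by positivity) (by positivity)]
      have h2 := Real.log_le_sub_one_of_pos (show (0 : ℝ) < r / (r + 1) by positivity)
      rw [Real.log_div (by positivity) (by positivity)] at h2
      have h3 : ((r : ℝ) + 1) * (r / (r + 1) - 1) = -1 := by field_simp; ring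
      have h4 := mul_le_mul_of_nonneg_left h2 (show (0 : ℝ) ≤ r + 1 by positivity)
      rw [h3] at h4
      rw [h1]
      push_cast
      nlinarith
  have hr' : (0 : ℝ) < r := by exact_mod_cast hr
  unfold logGeomFactorial
  rw [div_le_iff₀ hr']
  have : (Real.log r - 1 + (1 + Real.log r) / r) * r =
      1 + Real.log r + r * Real.log r - r := by
    field_simp
    ring
  linarith

theorem choose_le_exp_mul_log_sub_two {m b : ℕ} {ρ : ℝ} (hb : 0 < b) (hρ : 0 < ρ)
    (hm : m * Real.exp 1 ^ 3 ≤ b * ρ) :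
    (m.choose b : ℝ) ≤ Real.exp (b * (Real.log ρ - 2)) := by
  have hb' : (0 : ℝ) < b := by exact_mod_cast hb
  have he := Real.exp_pos 1
  have h1 : (m.choose b : ℝ) ≤ (m : ℝ) ^ b / b.factorial := Nat.choose_le_pow_div b m
  have h2 : (b : ℝ) ^ b / b.factorial ≤ Real.exp b := Real.pow_div_factorial_le_exp b hb'.le b
  have hf : (0 : ℝ) < b.factorial := by exact_mod_cast b.factorial_pos
  have h3 : (m : ℝ) ≤ b * (ρ / Real.exp 1 ^ 3) := by
    rw [← mul_div_assoc, le_div_iff₀ (by positivity)]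
    exact hm
  calc (m.choose b : ℝ) ≤ (m : ℝ) ^ b / b.factorial := h1
    _ ≤ (b * (ρ / Real.exp 1 ^ 3)) ^ b / b.factorial := by gcongr
    _ = (b : ℝ) ^ b / b.factorial * (ρ / Real.exp 1 ^ 3) ^ b := by rw [mul_pow]; ring
    _ ≤ Real.exp b * (ρ / Real.exp 1 ^ 3) ^ b := by gcongr
    _ = Real.exp (b * (Real.log ρ - 2)) := by
      have : ρ / Real.exp 1 ^ 3 = Real.exp (Real.log ρ - 3) := by
        rw [Real.exp_sub, Real.exp_log hρ, ← Real.exp_nat_mul]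
        norm_num
      rw [this, ← Real.exp_nat_mul, ← Real.exp_add]
      ring_nf

theorem div_exp_pow_eq {ρ : ℝ} (hρ : 0 < ρ) (n : ℕ) :
    (ρ / Real.exp 1) ^ n = Real.exp (n * (Real.log ρ - 1)) := by
  rw [Real.exp_nat_mul, Real.exp_sub, Real.exp_log hρ]

theorem choose_mul_exp_logGeomFactorial_le {m b n ρ : ℕ} {θ : ℝ} (hb : 0 < b) (hbn : b ≤ n)
    (hρ : 0 < ρ) (hθ : 0 < θ) (hθ' : θ ≤ 1) (hn : (ρ : ℝ) = θ * n)
    (hm : m * Real.exp 1 ^ 3 ≤ b * (ρ : ℝ)) :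
    (m.choose b : ℝ) * Real.exp ((n - b) * logGeomFactorial ρ) ≤
      (ρ / Real.exp 1) ^ n * Real.exp ((1 + Real.log n) / θ - b) := by
  have hρ' : (0 : ℝ) < ρ := by exact_mod_cast hρ
  have hn' : (0 : ℝ) < n := by exact_mod_cast hb.trans_le hbn
  have hbn' : (b : ℝ) ≤ n := by exact_mod_cast hbn
  have hlog : 0 ≤ Real.log ρ := Real.log_nonneg (by exact_mod_cast hρ)
  have hlog' : Real.log ρ ≤ Real.log n := Real.log_le_log hρ' (by rw [hn]; nlinarith)
  refine (mul_le_mul_of_nonneg_right (choose_le_exp_mul_log_sub_two hb hρ' hm)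
    (Real.exp_pos _).le).trans ?_
  rw [div_exp_pow_eq hρ', ← Real.exp_add, ← Real.exp_add, Real.exp_le_exp]
  have h1 := mul_le_mul_of_nonneg_left (logGeomFactorial_le hρ) (sub_nonneg.2 hbn')
  have h2 : ((n : ℝ) - b) * ((1 + Real.log ρ) / ρ) ≤ (1 + Real.log n) / θ := by
    calc ((n : ℝ) - b) * ((1 + Real.log ρ) / ρ) ≤ n * ((1 + Real.log n) / ρ) := by
          gcongr
          simp
      _ = (1 + Real.log n) / θ := by rw [hn]; field_simp
  nlinarith

theorem eventually_mul_exp_lt {θ₂ θ₃ : ℝ} (h₂ : 0 < θ₂) :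
    ∀ᶠ n : ℕ in atTop,
      5 * (n : ℝ) * Real.exp ((1 + Real.log n) / θ₃ - θ₂ * Real.sqrt n) < 1 / 2 := by
  have h0 : Tendsto (fun n : ℕ => (n : ℝ)) atTop atTop := tendsto_natCast_atTop_atTop
  have hlo : (fun x : ℝ => Real.log x) =o[atTop] fun x => Real.sqrt x := by
    simpa [Real.sqrt_eq_rpow] using isLittleO_log_rpow_atTop (r := 1 / 2) (by norm_num)
  have hc : (fun _ : ℝ => (Real.log 10 + 1 / θ₃)) =o[atTop] fun x => Real.sqrt x := by
    refine Asymptotics.isLittleO_const_left.2 (Or.inr ?_)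
    exact tendsto_norm_atTop_atTop.comp Real.tendsto_sqrt_atTop
  have h := ((hlo.const_mul_left (1 + 1 / θ₃)).add hc).def (half_pos h₂)
  filter_upwards [h0.eventually h, eventually_gt_atTop 0] with n hn hpos
  have hn' : (0 : ℝ) < n := by exact_mod_cast hpos
  have hs : 0 < Real.sqrt n := Real.sqrt_pos.2 hn'
  rw [Real.norm_of_nonneg hs.le] at hn
  have hn2 := (le_abs_self _).trans hn
  have : 5 * (n : ℝ) = Real.exp (Real.log 10 + Real.log n) / 2 := by
    rw [Real.exp_add, Real.exp_log hn', Real.exp_log (by norm_num)]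
    ring
  rw [this, div_mul_eq_mul_div, ← Real.exp_add]
  refine div_lt_div_of_pos_right (Real.exp_lt_one_iff.2 ?_) (by norm_num)
  have e : (1 + Real.log n) / θ₃ = 1 / θ₃ + 1 / θ₃ * Real.log n := by ring
  rw [e]
  nlinarith

theorem eventually_pow_div_rpow_lt {θ : ℝ} (hθ : 0 < θ) :
    ∀ᶠ n : ℕ in atTop, ∀ ρ : ℝ, ρ = θ * n →
      2 ^ n * (ρ ^ n / ρ ^ ((n : ℝ) / Real.log n ^ ((1 : ℝ) / 5))) <
        (ρ / Real.exp 1) ^ n / 2 := by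
  have h0 : Tendsto (fun n : ℕ => Real.log (n : ℝ)) atTop atTop :=
    Real.tendsto_log_atTop.comp tendsto_natCast_atTop_atTop
  have h1 := (tendsto_rpow_atTop (show (0 : ℝ) < 4 / 5 by norm_num)).comp h0
  filter_upwards [h0.eventually_ge_atTop (-2 * Real.log θ), h0.eventually_gt_atTop 0,
    h1.eventually_gt_atTop 6, eventually_gt_atTop 0] with n ha hl hb hpos ρ hρn
  have hn' : (1 : ℝ) ≤ n := by exact_mod_cast hpos
  have hρ : 0 < ρ := by rw [hρn]; positivity
  have hlρ : Real.log n / 2 ≤ Real.log ρ := by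
    rw [hρn, Real.log_mul hθ.ne' (by positivity)]
    linarith
  simp only [Function.comp] at hb
  set L := Real.log (n : ℝ) with hL
  have hLp : 0 < L ^ ((1 : ℝ) / 5) := Real.rpow_pos_of_pos hl _
  have hK : 3 * (n : ℝ) < n / L ^ ((1 : ℝ) / 5) * Real.log ρ := by
    have e : L = L ^ ((4 : ℝ) / 5) * L ^ ((1 : ℝ) / 5) := by
      rw [← Real.rpow_add hl]
      norm_num
    calc 3 * (n : ℝ) < n * L ^ ((4 : ℝ) / 5) / 2 := by nlinarith
      _ = n / L ^ ((1 : ℝ) / 5) * (L / 2) := by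
        field_simp
        exact e.symm
      _ ≤ _ := by gcongr
  have hl2 : Real.log 2 < 1 := Real.log_two_lt_d9.trans (by norm_num)
  have e2 : ∀ k : ℕ, (2 : ℝ) ^ k = Real.exp (k * Real.log 2) := fun k => by
    rw [Real.exp_nat_mul, Real.exp_log (by norm_num)]
  have e3 : ρ ^ n = Real.exp (n * Real.log ρ) := by
    rw [Real.exp_nat_mul, Real.exp_log hρ]
  rw [div_exp_pow_eq hρ, Real.rpow_def_of_pos hρ, e2, e3, ← Real.exp_sub, ← Real.exp_add,
    show (2 : ℝ) = Real.exp (Real.log 2) by rw [Real.exp_log (by norm_num)], ← Real.exp_sub,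
    Real.exp_lt_exp, Real.log_exp]
  nlinarith

end Asymptotics

/-- a large dense regular oriented graph has a 1-factor (a permutation `σ`
with all edges `v → σ v` in `G`) with few cycles and few edges of a given sparse subgraph
`H` incident to each of the given sets `A i`. -/
theorem one_factor_with_few_cycles_avoiding_sparse_subgraph :
    ∀ θ₂ : ℝ, 0 < θ₂ → θ₂ < 1/2 →
    ∃ δ : ℝ, 0 < δ ∧
    ∀ θ₁ θ₃ : ℝ, 0 < θ₁ → θ₁ < 1/2 → 0 < θ₃ → θ₃ < 1/2 → θ₁ / θ₃ ≤ δ →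
    ∃ n₀ : ℕ,
    ∀ (V : Type) [Fintype V] [DecidableEq V], n₀ ≤ Fintype.card V →
    ∀ G : V → V → Prop,
      (∀ v, ¬ G v v) →
      (∀ u v : V, G u v → ¬ G v u) →
    ∀ ρ : ℕ, (ρ : ℝ) = θ₃ * (Fintype.card V : ℝ) →
      (∀ v, outDeg G v = ρ ∧ inDeg G v = ρ) →
    ∀ A : Fin (5 * Fintype.card V) → Finset V,
      (∀ i, Real.sqrt (Fintype.card V : ℝ) ≤ ((A i).card : ℝ)) →
    ∀ H : V → V → Prop,
      (∀ u v : V, H u v → G u v) →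
      (∀ i, ∀ x ∈ A i, (outDeg H x : ℝ) ≤ θ₁ * (Fintype.card V : ℝ) ∧
                        (inDeg H x : ℝ) ≤ θ₁ * (Fintype.card V : ℝ)) →
    ∃ σ : Equiv.Perm V,
      (∀ v, G v (σ v)) ∧
      ((σ.cycleType.card : ℝ) ≤
        (Fintype.card V : ℝ) / (Real.log (Fintype.card V : ℝ)) ^ ((1:ℝ)/5)) ∧
      (∀ i, ((Finset.univ.filter fun v => H v (σ v) ∧ (v ∈ A i ∨ σ v ∈ A i)).card : ℝ) ≤
            θ₂ * ((A i).card : ℝ)) := by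

  intro θ₂ h₂ _
  have he := Real.exp_pos 1
  refine ⟨θ₂ / (2 * Real.exp 1 ^ 3), by positivity, fun θ₁ θ₃ h₁ _ h₃ h₃' hratio => ?_⟩
  obtain ⟨n₀, hn₀⟩ := Filter.eventually_atTop.1 ((eventually_mul_exp_lt (θ₃ := θ₃) h₂).and
    ((eventually_pow_div_rpow_lt h₃).and (Filter.eventually_gt_atTop 0)))
  refine ⟨n₀, ?_⟩
  intro V _ _ hV G _ _ ρ hρn hG A hA H _ hH
  obtain ⟨hsmall, hcyc, hn⟩ := hn₀ _ hV
  have hcyc := hcyc ρ hρn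
  obtain ⟨n, hnV⟩ : ∃ n, n = Fintype.card V := ⟨_, rfl⟩
  rw [← hnV] at hsmall hcyc hn hρn
  have hn' : (0 : ℝ) < n := by exact_mod_cast hn
  have hρ' : (0 : ℝ) < ρ := by rw [hρn]; positivity
  have hρ : 0 < ρ := by exact_mod_cast hρ'
  by_contra hcon
  obtain ⟨E, hE⟩ : ∃ E : Fin (5 * Fintype.card V) → V → V → Prop,
      ∀ i u v, E i u v ↔ H u v ∧ (u ∈ A i ∨ v ∈ A i) := ⟨_, fun _ _ _ => Iff.rfl⟩
  let b : Fin (5 * Fintype.card V) → ℕ := fun i => ⌊θ₂ * (A i).card⌋₊ + 1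
  let K : ℝ := (n : ℝ) / Real.log n ^ ((1 : ℝ) / 5)
  let B₁ := (permsIn G).filter fun σ => K < σ.cycleType.card
  let B₂ := fun i => (permsIn G).filter fun σ =>
    b i ≤ (Finset.univ.filter fun v => E i v (σ v)).card
  have hcover : permsIn G ⊆ B₁ ∪ Finset.univ.biUnion B₂ := by
    intro σ hσ
    by_contra hgood
    rw [Finset.mem_union, Finset.mem_biUnion, not_or] at hgood
    refine hcon ⟨σ, mem_permsIn.1 hσ, ?_, fun i => ?_⟩
    · rw [← hnV]
      by_contra hlt
      exact hgood.1 (Finset.mem_filter.2 ⟨hσ, not_le.1 hlt⟩)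
    · by_contra hlt
      refine hgood.2 ⟨i, Finset.mem_univ _, Finset.mem_filter.2 ⟨hσ, ?_⟩⟩
      rw [not_le, ← Nat.floor_lt (by positivity)] at hlt
      simpa only [hE] using Nat.succ_le_of_lt hlt
  have hB₁ : (B₁.card : ℝ) < (ρ / Real.exp 1) ^ n / 2 := by
    have := card_filter_cycleType_le hρ (fun v => (hG v).1) K
    rw [← hnV] at this
    exact this.trans_lt hcyc
  have hB₂ : ∀ i, ((B₂ i).card : ℝ) ≤ (ρ / Real.exp 1) ^ n *
      Real.exp ((1 + Real.log n) / θ₃ - θ₂ * Real.sqrt n) := by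
    intro i
    have hθb : θ₂ * (A i).card ≤ b i := by
      have := (Nat.lt_floor_add_one (θ₂ * ((A i).card : ℝ))).le
      simpa [b] using this
    by_cases hbn : b i ≤ n
    swap
    · have : B₂ i = ∅ := Finset.filter_eq_empty_iff.2 fun σ _ hσ =>
        hbn (hσ.trans (hnV ▸ Finset.card_le_univ _))
      rw [this, Finset.card_empty, Nat.cast_zero]
      positivity
    have h1 := card_filter_many_edges_le (E := E i) (fun v => (hG v).1.le) (b i)
    rw [← hnV] at h1
    have hm := card_edges_incident_le (hH i)
    rw [← hnV] at hm
    simp only [← hE] at hm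
    refine h1.trans ((choose_mul_exp_logGeomFactorial_le (Nat.succ_pos _) hbn hρ h₃
      (by linarith) hρn ?_).trans ?_)
    · have hθ : 2 * θ₁ * Real.exp 1 ^ 3 ≤ θ₂ * θ₃ := by
        rw [div_le_div_iff₀ h₃ (by positivity)] at hratio
        linarith
      calc _ ≤ 2 * ((A i).card : ℝ) * (θ₁ * n) * Real.exp 1 ^ 3 := by gcongr
        _ = (2 * θ₁ * Real.exp 1 ^ 3) * ((A i).card * n) := by ring
        _ ≤ (θ₂ * θ₃) * ((A i).card * n) := by gcongr
        _ = (θ₂ * (A i).card) * (θ₃ * n) := by ring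
        _ ≤ b i * (θ₃ * n) := by gcongr
        _ = b i * (ρ : ℝ) := by rw [hρn]
    · gcongr
      have := hA i
      rw [← hnV] at this
      exact (mul_le_mul_of_nonneg_left this h₂.le).trans hθb
  have hunion : ((permsIn G).card : ℝ) ≤ B₁.card + ∑ i, ((B₂ i).card : ℝ) := by
    exact_mod_cast (Finset.card_le_card hcover).trans ((Finset.card_union_le _ _).trans
      (Nat.add_le_add_left Finset.card_biUnion_le _))
  have hsum : ∑ i, ((B₂ i).card : ℝ) ≤ 5 * n * ((ρ / Real.exp 1) ^ n *
      Real.exp ((1 + Real.log n) / θ₃ - θ₂ * Real.sqrt n)) := by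
    refine (Finset.sum_le_sum fun i _ => hB₂ i).trans ?_
    rw [Finset.sum_const, nsmul_eq_mul, Finset.card_univ, Fintype.card_fin, ← hnV]
    push_cast
    rfl
  have hlower := pow_div_exp_le_card_permsIn hρ hG
  rw [← hnV] at hlower
  have hN : 0 < ((ρ : ℝ) / Real.exp 1) ^ n := by positivity
  nlinarith [mul_lt_mul_of_pos_left hsmall hN]
end
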